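/- For all integers n ≥ 1 and d ≥ 1 there exists a constant c = c(n,d) > 0 such that for every r > 0, every λ ≥ 0, and every C^d function f : B^n_r → ℝ, the set Δ(f,λ) = f({x ∈ B^n_r : ‖∇f(x)‖ ≤ λ}) of λ-near-critical values of f satisfies: (i) for every ε ≥ R_d(f), M(ε, Δ(f,λ)) ≤ c · (1 + λ·(r/ε)); (ii) for every ε with 0 < ε ≤ R_d(f), M(ε, Δ(f,λ)) ≤ c · [ (R_d(f)/ε)^{n/d} + λ·(r/ε)·(R_d(f)/ε)^{(n-1)/d} ]. -/

import Mathlib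

open Metric Set

/-- The covering number `M(ε, S)`: the minimal number of closed intervals of
radius `ε` needed to cover `S ⊆ ℝ`. -/
noncomputable def coveringNumber (ε : ℝ) (S : Set ℝ) : ℕ :=
  sInf {N : ℕ | ∃ t : Finset ℝ, t.card = N ∧ S ⊆ ⋃ c ∈ t, Metric.closedBall c ε}

/-- The Taylor constant `R_d(f) = (r^d/d!) · sup_{x ∈ B^n_r} ‖D^d f(x)‖`. -/
noncomputable def taylorConst (n d : ℕ) (r : ℝ) (f : EuclideanSpace ℝ (Fin n) → ℝ) : ℝ :=
  (r ^ d / d.factorial) *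
    ⨆ x ∈ closedBall (0 : EuclideanSpace ℝ (Fin n)) r,
      ‖iteratedFDerivWithin ℝ d f (closedBall (0 : EuclideanSpace ℝ (Fin n)) r) x‖

/-- The set of λ-near-critical values of `f` on the ball of radius `r`:
`Δ(f,λ) = f({x ∈ B^n_r : ‖∇f(x)‖ ≤ λ})`. -/
noncomputable def nearCritValues (n : ℕ) (r lam : ℝ) (f : EuclideanSpace ℝ (Fin n) → ℝ) :
    Set ℝ :=
  f '' {x ∈ closedBall (0 : EuclideanSpace ℝ (Fin n)) r |
    ‖fderivWithin ℝ f (closedBall (0 : EuclideanSpace ℝ (Fin n)) r) x‖ ≤ lam}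

open MvPolynomial MeasureTheory in
theorem ae_eval_ne_zero : ∀ (m : ℕ) (A : MvPolynomial (Fin m) ℝ), A ≠ 0 →
    ∀ᵐ y : Fin m → ℝ, eval y A ≠ 0
  | 0, A, hA => by
    refine Filter.Eventually.of_forall fun y hy => hA ?_
    refine MvPolynomial.funext fun x => ?_
    rw [Subsingleton.elim x y, hy, map_zero]
  | m + 1, A, hA => by
    have hQ : finSuccEquiv ℝ m A ≠ 0 := by simpa using hA
    have hlead := ae_eval_ne_zero m _ (Polynomial.leadingCoeff_ne_zero.mpr hQ)
    have hmp := volume_preserving_piFinSuccAbove (fun _ : Fin (m + 1) => ℝ) 0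
    have hmeas : MeasurableSet {z : ℝ × (Fin m → ℝ) | eval (Fin.cons z.1 z.2) A ≠ 0} := by
      refine (isOpen_ne_fun ?_ continuous_const).measurableSet
      exact (MvPolynomial.continuous_eval A).comp (by fun_prop)
    have key : ∀ᵐ z : ℝ × (Fin m → ℝ), eval (Fin.cons z.1 z.2) A ≠ 0 := by
      rw [Measure.volume_eq_prod]
      have hsw : ∀ᵐ z : (Fin m → ℝ) × ℝ, eval (Fin.cons z.2 z.1) A ≠ 0 := by
        rw [Measure.volume_eq_prod]
        refine (Measure.ae_prod_iff_ae_ae ?_).2 ?_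
        · exact measurable_swap hmeas
        · filter_upwards [hlead] with y hy
          have hne : (finSuccEquiv ℝ m A).map (eval y) ≠ 0 := fun h0 => hy (by
            have := congrArg (fun Q => Q.coeff (finSuccEquiv ℝ m A).natDegree) h0
            simpa [Polynomial.coeff_map] using this)
          have hfin : {t : ℝ | ((finSuccEquiv ℝ m A).map (eval y)).IsRoot t}.Finite :=
            Polynomial.finite_setOfPred_isRoot hne
          filter_upwards [hfin.countable.ae_notMem volume] with t ht h0
          refine ht ?_
          simp only [Polynomial.IsRoot]
          rw [← h0, eval_eq_eval_mv_eval']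
      exact (Measure.measurePreserving_swap (μ := volume) (ν := volume)).quasiMeasurePreserving.ae
        (p := fun z : (Fin m → ℝ) × ℝ => eval (Fin.cons z.2 z.1) A ≠ 0) hsw
    filter_upwards [hmp.quasiMeasurePreserving.ae key] with y hy
    simpa [MeasurableEquiv.piFinSuccAbove, Fin.insertNthEquiv, Fin.removeNth_zero] using hy

open MvPolynomial in
theorem exists_relation (m L : ℕ) : ∃ e : ℕ, ∀ (P : Fin m → MvPolynomial (Fin m) ℝ)
    (h : MvPolynomial (Fin m) ℝ), (∀ i, (P i).totalDegree ≤ L) → h.totalDegree ≤ L →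
    ∃ c : (Fin m → Fin (e + 1)) × Fin (e + 1) → ℝ, c ≠ 0 ∧
      ∑ a, c a • ((∏ i, P i ^ (a.1 i : ℕ)) * h ^ (a.2 : ℕ)) = 0 := by
  set e := ((m + 1) * L + 1) ^ m with he
  refine ⟨e, fun P h hP hh => ?_⟩
  set N := (m + 1) * e * L with hN
  let F : (Fin m → Fin (e + 1)) × Fin (e + 1) → MvPolynomial (Fin m) ℝ :=
    fun a => (∏ i, P i ^ (a.1 i : ℕ)) * h ^ (a.2 : ℕ)
  have hF : ∀ a, (F a).totalDegree ≤ N := by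
    intro a
    refine (totalDegree_mul _ _).trans ?_
    have h1 : (∏ i, P i ^ (a.1 i : ℕ)).totalDegree ≤ m * (e * L) := by
      refine (totalDegree_finsetProd _ _).trans ?_
      refine (Finset.sum_le_card_nsmul _ _ (e * L) fun i _ => ?_).trans (by simp)
      exact (totalDegree_pow _ _).trans (Nat.mul_le_mul (by omega) (hP i))
    have h2 : (h ^ (a.2 : ℕ)).totalDegree ≤ e * L :=
      (totalDegree_pow _ _).trans (Nat.mul_le_mul (by omega) hh)
    calc _ ≤ m * (e * L) + e * L := add_le_add h1 h2
      _ = N := by rw [hN]; ring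
  let T : ((Fin m → Fin (e + 1)) × Fin (e + 1) → ℝ) →ₗ[ℝ] ((Fin m → Fin (N + 1)) → ℝ) :=
    LinearMap.pi fun b => (lcoeff ℝ (Finsupp.equivFunOnFinite.symm fun i => (b i : ℕ))).comp
      (Fintype.linearCombination ℝ F)
  have hdim : Module.finrank ℝ ((Fin m → Fin (N + 1)) → ℝ) <
      Module.finrank ℝ ((Fin m → Fin (e + 1)) × Fin (e + 1) → ℝ) := by
    simp only [Module.finrank_fintype_fun_eq_card, Fintype.card_prod, Fintype.card_fun,
      Fintype.card_fin]
    have h1 : N + 1 ≤ (e + 1) * ((m + 1) * L + 1) := by rw [hN]; nlinarith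
    calc (N + 1) ^ m ≤ ((e + 1) * ((m + 1) * L + 1)) ^ m := Nat.pow_le_pow_left h1 m
      _ = (e + 1) ^ m * e := by rw [mul_pow, he]
      _ < (e + 1) ^ m * (e + 1) := by
        exact Nat.mul_lt_mul_of_pos_left (by omega) (by positivity)
  obtain ⟨c, hc, hc0⟩ := (Submodule.ne_bot_iff _).1 (LinearMap.ker_ne_bot_of_finrank_lt (f := T) hdim)
  refine ⟨c, hc0, ?_⟩
  have hsum : (∑ a, c a • F a).totalDegree ≤ N := by
    refine totalDegree_finsetSum_le fun a _ => ?_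
    exact (totalDegree_smul_le _ _).trans (hF a)
  ext b
  rw [coeff_zero]
  by_cases hb : ∀ i, b i ≤ N
  · have := congrFun (LinearMap.mem_ker.1 hc) fun i => ⟨b i, Nat.lt_succ_of_le (hb i)⟩
    have hbb : (Finsupp.equivFunOnFinite.symm fun i => b i) = b := by ext; simp
    simpa [T, Fintype.linearCombination_apply, F, hbb, coeff_sum] using this
  · push Not at hb
    obtain ⟨i, hi⟩ := hb
    refine coeff_eq_zero_of_totalDegree_lt (lt_of_le_of_lt hsum (hi.trans_le ?_))
    by_cases hbi : i ∈ b.support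
    · exact Finset.single_le_sum (f := fun i => b i) (fun _ _ => Nat.zero_le _) hbi
    · simp at hbi; omega

open MvPolynomial MeasureTheory in
theorem exists_fiber_bound (m L : ℕ) : ∃ K : ℕ, ∀ P : Fin m → MvPolynomial (Fin m) ℝ,
    (∀ i, (P i).totalDegree ≤ L) →
    ∀ᵐ y : Fin m → ℝ, {x : Fin m → ℝ | (fun i => eval x (P i)) = y}.encard ≤ K := by
  obtain ⟨e, he⟩ := exists_relation m (max L 1)
  refine ⟨e ^ m, fun P hP => ?_⟩
  have hcoord : ∀ j : Fin m, ∀ᵐ y : Fin m → ℝ, ∃ S : Finset ℝ, S.card ≤ e ∧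
      ∀ x : Fin m → ℝ, (fun i => eval x (P i)) = y → x j ∈ S := by
    intro j
    obtain ⟨c, hc0, hc⟩ := he P (X j) (fun i => (hP i).trans (le_max_left _ _))
      (by simp)
    obtain ⟨⟨a0, k0⟩, hk⟩ := Function.ne_iff.1 hc0
    let A : Fin (e + 1) → MvPolynomial (Fin m) ℝ := fun k =>
      ∑ a : Fin m → Fin (e + 1),
        monomial (Finsupp.equivFunOnFinite.symm fun i => (a i : ℕ)) (c (a, k))
    have hA : A k0 ≠ 0 := by
      intro h0
      have := congrArg (coeff (Finsupp.equivFunOnFinite.symm fun i => (a0 i : ℕ))) h0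
      simp only [A, coeff_sum, coeff_monomial, coeff_zero] at this
      rw [Finset.sum_eq_single a0] at this
      · simp at this; exact hk this
      · intro b _ hb
        rw [if_neg]
        intro h
        apply hb
        funext i
        have := DFunLike.congr_fun h i
        simp at this
        exact Fin.ext this
      · simp
    filter_upwards [ae_eval_ne_zero m _ hA] with y hy
    let Q : Polynomial ℝ := ∑ k : Fin (e + 1), Polynomial.monomial (k : ℕ) (eval y (A k))
    have hQ : Q ≠ 0 := by
      intro h0
      have := congrArg (fun q => q.coeff (k0 : ℕ)) h0
      simp only [Q, Polynomial.finsetSum_coeff, Polynomial.coeff_monomial,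
        Polynomial.coeff_zero] at this
      rw [Finset.sum_eq_single k0] at this
      · simp at this; exact hy this
      · intro b _ hb
        rw [if_neg]
        exact fun h => hb (Fin.ext h)
      · simp
    have hdeg : Q.natDegree ≤ e := by
      refine Polynomial.natDegree_sum_le_of_forall_le _ _ fun k _ => ?_
      exact (Polynomial.natDegree_monomial_le _).trans (by omega)
    refine ⟨Q.roots.toFinset, (Multiset.toFinset_card_le _).trans
      ((Polynomial.card_roots' _).trans hdeg), fun x hx => ?_⟩
    rw [Multiset.mem_toFinset, Polynomial.mem_roots hQ, Polynomial.IsRoot]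
    have h2 := congrArg (eval x) hc
    simp only [map_sum, smul_eval, map_mul, map_prod, map_pow, eval_X, map_zero] at h2
    rw [← h2, Fintype.sum_prod_type_right]
    simp only [Q, Polynomial.eval_finsetSum, Polynomial.eval_monomial, A, map_sum,
      eval_monomial]
    refine Finset.sum_congr rfl fun k _ => Finset.sum_congr rfl fun a _ => ?_
    rw [Finsupp.prod_fintype _ _ (by simp), ← hx]
    simp [mul_assoc]
  filter_upwards [ae_all_iff.2 hcoord] with y hy
  choose S hS hxS using hy
  calc _ ≤ ((Fintype.piFinset S : Finset (Fin m → ℝ)) : Set (Fin m → ℝ)).encard := by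
        refine encard_le_encard fun x hx => ?_
        simpa using fun j => hxS j x hx
    _ ≤ _ := by
        rw [encard_coe_eq_coe_finsetCard, Fintype.card_piFinset]
        norm_cast
        refine (Finset.prod_le_pow_card _ _ e fun j _ => hS j).trans (by simp)

open MeasureTheory in
theorem exists_injOn_of_approximatesLinearOn {E : Type*} [NormedAddCommGroup E] [NormedSpace ℝ E]
    [FiniteDimensional ℝ E] (A : E →L[ℝ] E) :
    ∃ δ : NNReal, δ ≠ 0 ∧ (A.det ≠ 0 → ∀ (f : E → E) (t : Set E),
      ApproximatesLinearOn f A t δ → InjOn f t) := by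
  by_cases hA : A.det = 0
  · exact ⟨1, one_ne_zero, fun h => absurd hA h⟩
  · let B := A.toContinuousLinearEquivOfDetNeZero hA
    have hB : (B : E →L[ℝ] E) = A := A.coe_toContinuousLinearEquivOfDetNeZero hA
    rcases subsingleton_or_nontrivial E with hE | hE
    · exact ⟨1, one_ne_zero, fun _ f t _ => Set.injOn_of_subsingleton f t⟩
    · have hpos : 0 < ‖(B.symm : E →L[ℝ] E)‖₊⁻¹ := by
        rw [inv_pos]
        exact B.nnnorm_symm_pos
      refine ⟨‖(B.symm : E →L[ℝ] E)‖₊⁻¹ / 2, (half_pos hpos).ne', fun _ f t hf => ?_⟩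
      rw [← hB] at hf
      exact hf.injOn (Or.inr (half_lt_self hpos))

open MeasureTheory in
theorem lintegral_abs_det_le_of_encard_fiber_le {m : ℕ} {f : (Fin m → ℝ) → (Fin m → ℝ)}
    {f' : (Fin m → ℝ) → (Fin m → ℝ) →L[ℝ] (Fin m → ℝ)} {s Q : Set (Fin m → ℝ)}
    (hs : MeasurableSet s) (hf' : ∀ x, HasFDerivAt f (f' x) x)
    (hdet : Measurable fun x => (f' x).det) (hQ : MeasurableSet Q) (hsQ : MapsTo f s Q) (K : ℕ)
    (hK : ∀ᵐ y, {x | f x = y}.encard ≤ K) :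
    ∫⁻ x in s, ENNReal.ofReal |(f' x).det| ≤ K * volume Q := by
  set s' := s ∩ {x | (f' x).det ≠ 0} with hs'def
  have hs' : MeasurableSet s' := hs.inter (hdet (measurableSet_singleton 0).compl)
  choose r hr0 hr using fun A : (Fin m → ℝ) →L[ℝ] (Fin m → ℝ) =>
    exists_injOn_of_approximatesLinearOn A
  obtain ⟨t, A, htd, htm, hst, htA, hA⟩ :=
    exists_partition_approximatesLinearOn_of_hasFDerivWithinAt f s' f'
      (fun x _ => (hf' x).hasFDerivWithinAt) r hr0
  have hinj : ∀ n, InjOn f (s' ∩ t n) := by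
    intro n
    rcases s'.eq_empty_or_nonempty with h | h
    · rw [h, empty_inter]; exact injOn_empty f
    · obtain ⟨y, hy, hAy⟩ := hA h n
      exact hr (A n) (by rw [hAy]; exact hy.2) f _ (htA n)
  have hmeas : ∀ n, MeasurableSet (f '' (s' ∩ t n)) := fun n =>
    measurable_image_of_fderivWithin (hs'.inter (htm n))
      (fun x _ => (hf' x).hasFDerivWithinAt) (hinj n)
  have h1 : ∫⁻ x in s, ENNReal.ofReal |(f' x).det| =
      ∫⁻ x in s', ENNReal.ofReal |(f' x).det| := by
    rw [hs'def, ← lintegral_indicator hs, ← lintegral_indicator hs']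
    congr 1
    funext x
    by_cases hx : x ∈ s <;> by_cases hd : (f' x).det = 0 <;>
      simp [indicator, hs'def, hx, hd]
  have h2 : ∫⁻ x in s', ENNReal.ofReal |(f' x).det| = ∑' n, volume (f '' (s' ∩ t n)) := by
    have hU : s' = ⋃ n, s' ∩ t n := by
      rw [← inter_iUnion]; exact (inter_eq_left.2 hst).symm
    conv_lhs => rw [hU]
    rw [lintegral_iUnion (fun n => hs'.inter (htm n))]
    · refine tsum_congr fun n => ?_
      exact lintegral_abs_det_fderiv_eq_addHaar_image volume (hs'.inter (htm n))
        (fun x _ => (hf' x).hasFDerivWithinAt) (hinj n)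
    · exact fun i j hij => (htd hij).mono inter_subset_right inter_subset_right
  rw [h1, h2]
  calc ∑' n, volume (f '' (s' ∩ t n))
      = ∑' n, ∫⁻ y, (f '' (s' ∩ t n)).indicator 1 y := by
        refine tsum_congr fun n => (lintegral_indicator_one (hmeas n)).symm
    _ = ∫⁻ y, ∑' n, (f '' (s' ∩ t n)).indicator 1 y :=
        (lintegral_tsum fun n => (measurable_one.indicator (hmeas n)).aemeasurable).symm
    _ ≤ ∫⁻ y, Q.indicator (fun _ => (K : ENNReal)) y := by
        refine lintegral_mono_ae ?_
        filter_upwards [hK] with y hy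
        by_cases hyQ : y ∈ Q
        · rw [indicator_of_mem hyQ]
          refine ENNReal.tsum_le_of_sum_range_le fun N => ?_
          classical
          have hsum : ∑ n ∈ Finset.range N, (f '' (s' ∩ t n)).indicator (1 : (Fin m → ℝ) → ENNReal) y =
              (((Finset.range N).filter fun n => y ∈ f '' (s' ∩ t n)).card : ENNReal) := by
            simp [indicator_apply]
          rw [hsum]
          norm_cast
          choose! g hg using fun n (hn : y ∈ f '' (s' ∩ t n)) => hn
          have hle : ((((Finset.range N).filter fun n => y ∈ f '' (s' ∩ t n)) : Finset ℕ) :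
              Set ℕ).encard ≤ {x | f x = y}.encard := by
            refine encard_le_encard_of_injOn (f := g) ?_ ?_
            · intro n hn
              simp only [Finset.coe_filter, mem_ofPred_eq] at hn
              exact (hg n hn.2).2
            · intro n hn k hk hnk
              simp only [Finset.coe_filter, mem_ofPred_eq] at hn hk
              by_contra hne
              exact disjoint_left.1 (htd hne) (hg n hn.2).1.2 (hnk ▸ (hg k hk.2).1.2)
          rw [encard_coe_eq_coe_finsetCard] at hle
          exact_mod_cast hle.trans hy
        · rw [indicator_of_notMem hyQ]
          refine le_of_eq (ENNReal.tsum_eq_zero.2 fun n => indicator_of_notMem ?_ _)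
          rintro ⟨x, hx, rfl⟩
          exact hyQ (hsQ hx.1.1)
    _ = K * volume Q := by
        rw [lintegral_indicator hQ, setLIntegral_const]

open MvPolynomial in
theorem hasFDerivAt_eval {m : ℕ} (P : MvPolynomial (Fin m) ℝ) (x : Fin m → ℝ) :
    HasFDerivAt (fun x => eval x P)
      (∑ i, eval x (pderiv i P) • ContinuousLinearMap.proj (R := ℝ) (φ := fun _ => ℝ) i) x := by
  induction P using MvPolynomial.induction_on with
  | C a => simpa using hasFDerivAt_const a x
  | add p q hp hq =>
    simp only [map_add]
    refine (hp.add hq).congr_fderiv ?_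
    simp [add_smul, Finset.sum_add_distrib]
  | mul_X p j hp =>
    simp only [map_mul, eval_X]
    have hj : HasFDerivAt (fun x : Fin m → ℝ => x j)
      (ContinuousLinearMap.proj (R := ℝ) (φ := fun _ => ℝ) j) x := hasFDerivAt_apply j x
    refine (hp.mul hj).congr_fderiv ?_
    simp only [Derivation.leibniz, smul_eq_mul, map_add, map_mul, eval_X, add_smul,
      Finset.sum_add_distrib, pderiv_X, mul_smul]
    congr 1
    · rw [Finset.sum_eq_single j]
      · simp
      · intro b _ hb; simp [hb.symm]
      · simp
    · rw [Finset.smul_sum]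

open MvPolynomial in
/-- The Jacobian matrix of a polynomial map. -/
noncomputable def polyJacobian {m : ℕ} (P : Fin m → MvPolynomial (Fin m) ℝ) (x : Fin m → ℝ) :
    Matrix (Fin m) (Fin m) ℝ :=
  Matrix.of fun i j => eval x (pderiv j (P i))

open MvPolynomial in
theorem hasFDerivAt_polyMap {m : ℕ} (P : Fin m → MvPolynomial (Fin m) ℝ) (x : Fin m → ℝ) :
    HasFDerivAt (fun x i => eval x (P i))
      (LinearMap.toContinuousLinearMap (Matrix.toLin' (polyJacobian P x))) x := by
  rw [hasFDerivAt_pi']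
  intro i
  refine (hasFDerivAt_eval (P i) x).congr_fderiv ?_
  ext v
  simp [polyJacobian, Matrix.mulVec, dotProduct]

theorem det_toContinuousLinearMap_toLin' {m : ℕ} (J : Matrix (Fin m) (Fin m) ℝ) :
    (LinearMap.toContinuousLinearMap (Matrix.toLin' J)).det = J.det := by
  simp [ContinuousLinearMap.det]

open MvPolynomial in
theorem continuous_det_polyJacobian {m : ℕ} (P : Fin m → MvPolynomial (Fin m) ℝ) :
    Continuous fun x => (polyJacobian P x).det := by
  refine Continuous.matrix_det ?_
  refine continuous_matrix fun i j => ?_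
  exact MvPolynomial.continuous_eval _

open MvPolynomial MeasureTheory in
theorem exists_lintegral_polyJacobian_le (m L : ℕ) : ∃ K : ℕ,
    ∀ P : Fin m → MvPolynomial (Fin m) ℝ, (∀ i, (P i).totalDegree ≤ L) →
    ∀ s Q : Set (Fin m → ℝ), MeasurableSet s → MeasurableSet Q →
    MapsTo (fun x i => eval x (P i)) s Q →
    ∫⁻ x in s, ENNReal.ofReal |(polyJacobian P x).det| ≤ K * volume Q := by
  obtain ⟨K, hK⟩ := exists_fiber_bound m L
  refine ⟨K, fun P hP s Q hs hQ hsQ => ?_⟩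
  have := lintegral_abs_det_le_of_encard_fiber_le (f := fun x i => eval x (P i)) hs
    (hasFDerivAt_polyMap P) (by
      simp only [det_toContinuousLinearMap_toLin']
      exact (continuous_det_polyJacobian P).measurable) hQ hsQ K (hK P hP)
  simpa only [det_toContinuousLinearMap_toLin'] using this

open MvPolynomial MeasureTheory in
theorem volume_image_polyMap_le {m : ℕ} (P : Fin m → MvPolynomial (Fin m) ℝ)
    {s : Set (Fin m → ℝ)} (hs : MeasurableSet s) :
    volume ((fun x i => eval x (P i)) '' s) ≤
      ∫⁻ x in s, ENNReal.ofReal |(polyJacobian P x).det| := by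
  have := addHaar_image_le_lintegral_abs_det_fderiv volume hs
    (fun x _ => (hasFDerivAt_polyMap P x).hasFDerivWithinAt)
  simpa only [det_toContinuousLinearMap_toLin'] using this

open MvPolynomial in
theorem det_polyJacobian_cons {n : ℕ} (q : MvPolynomial (Fin (n + 1)) ℝ)
    (G : Fin n → MvPolynomial (Fin (n + 1)) ℝ) (x : Fin (n + 1) → ℝ) :
    (polyJacobian (Fin.cons q G) x).det =
      ∑ k, eval x (pderiv k q) * (polyJacobian (Fin.cons (X k) G) x).det := by
  rw [Matrix.det_eq_sum_mul_adjugate_row _ 0]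
  refine Finset.sum_congr rfl fun k _ => ?_
  rw [Matrix.adjugate_apply]
  congr 1
  · congr 1
    ext i j
    refine Fin.cases ?_ (fun i => ?_) i
    · simp [polyJacobian, pderiv_X, Pi.single_apply, eq_comm]
    · simp [polyJacobian, Matrix.updateRow_apply]

open MvPolynomial MeasureTheory in
theorem exists_volume_image_cons_le (n L : ℕ) : ∃ K : ℕ,
    ∀ (q : MvPolynomial (Fin (n + 1)) ℝ) (G : Fin n → MvPolynomial (Fin (n + 1)) ℝ),
    (∀ i, (G i).totalDegree ≤ L) → ∀ (c₀ c₁ : ℝ) (W : Set (Fin (n + 1) → ℝ)), 0 ≤ c₀ →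
    MeasurableSet W → (∀ x ∈ W, (∀ k, |x k| ≤ c₁) ∧ (∀ k, |eval x (pderiv k q)| ≤ c₀) ∧
      ∀ i, |eval x (G i)| ≤ 1) →
    volume ((fun x i => eval x ((Fin.cons q G : Fin (n + 1) → _) i)) '' W) ≤
      (n + 1) * (ENNReal.ofReal c₀ * (K * (ENNReal.ofReal (2 * c₁) * 2 ^ n))) := by
  obtain ⟨K, hK⟩ := exists_lintegral_polyJacobian_le (n + 1) (max 1 L)
  refine ⟨K, fun q G hG c₀ c₁ W hc₀ hW h => ?_⟩
  have hQ : volume (Icc (Fin.cons (-c₁) (fun _ => -1) : Fin (n + 1) → ℝ)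
      (Fin.cons c₁ (fun _ => 1))) = ENNReal.ofReal (2 * c₁) * 2 ^ n := by
    rw [Real.volume_Icc_pi, Fin.prod_univ_succ]
    simp only [Fin.cons_zero, Fin.cons_succ, Finset.prod_const, Finset.card_univ, Fintype.card_fin]
    congr 2
    · ring_nf
    · norm_num
  calc _ ≤ _ := volume_image_polyMap_le _ hW
    _ ≤ ∫⁻ x in W, ∑ k, ENNReal.ofReal c₀ *
          ENNReal.ofReal |(polyJacobian (Fin.cons (X k) G) x).det| := by
        refine setLIntegral_mono' hW fun x hx => ?_
        rw [det_polyJacobian_cons]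
        have : ∀ k, 0 ≤ c₀ * |(polyJacobian (Fin.cons (X k) G) x).det| := fun k => by positivity
        calc _ ≤ ENNReal.ofReal (∑ k, c₀ * |(polyJacobian (Fin.cons (X k) G) x).det|) := by
              apply ENNReal.ofReal_le_ofReal
              refine (Finset.abs_sum_le_sum_abs _ _).trans (Finset.sum_le_sum fun k _ => ?_)
              rw [abs_mul]
              exact mul_le_mul_of_nonneg_right ((h x hx).2.1 k) (abs_nonneg _)
          _ = _ := by
              rw [ENNReal.ofReal_sum_of_nonneg fun k _ => this k]
              simp only [ENNReal.ofReal_mul hc₀]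
    _ = ∑ k, ENNReal.ofReal c₀ *
          ∫⁻ x in W, ENNReal.ofReal |(polyJacobian (Fin.cons (X k) G) x).det| := by
        have hm : ∀ k : Fin (n + 1), Measurable fun x =>
            ENNReal.ofReal |(polyJacobian (Fin.cons (X k) G) x).det| := fun k =>
          (continuous_det_polyJacobian _).abs.measurable.ennreal_ofReal
        rw [lintegral_finsetSum _ fun k _ => (hm k).const_mul _]
        exact Finset.sum_congr rfl fun k _ => lintegral_const_mul _ (hm k)
    _ ≤ ∑ k : Fin (n + 1), ENNReal.ofReal c₀ * (K * (ENNReal.ofReal (2 * c₁) * 2 ^ n)) := by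
        refine Finset.sum_le_sum fun k _ => ?_
        gcongr
        rw [← hQ]
        refine hK _ ?_ _ _ hW measurableSet_Icc ?_
        · intro i
          refine Fin.cases ?_ (fun i => ?_) i
          · simp
          · simpa using Or.inr (hG i)
        · intro x hx
          constructor
          · intro i
            refine Fin.cases ?_ (fun i => ?_) i
            · simpa using (abs_le.1 ((h x hx).1 k)).1
            · simpa using (abs_le.1 ((h x hx).2.2 i)).1
          · intro i
            refine Fin.cases ?_ (fun i => ?_) i
            · simpa using (abs_le.1 ((h x hx).1 k)).2
            · simpa using (abs_le.1 ((h x hx).2.2 i)).2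
    _ = _ := by simp

open MvPolynomial in
theorem eval_pderiv_eq_of_hasFDerivAt {n : ℕ} {p : MvPolynomial (Fin n) ℝ} {x : Fin n → ℝ}
    {L : (Fin n → ℝ) →L[ℝ] ℝ} (h : HasFDerivAt (fun x => eval x p) L x) (i : Fin n) :
    eval x (pderiv i p) = L (Pi.single i 1) := by
  rw [h.unique (hasFDerivAt_eval p x)]
  simp [Pi.single_apply]

open MvPolynomial in
theorem eval_pderiv_eq_zero_of_isLocalExtr {n : ℕ} {p : MvPolynomial (Fin n) ℝ} {x : Fin n → ℝ}
    (h : IsLocalExtr (fun x => eval x p) x) (i : Fin n) : eval x (pderiv i p) = 0 := by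
  rw [eval_pderiv_eq_of_hasFDerivAt (hasFDerivAt_eval p x) i,
    h.hasFDerivAt_eq_zero (hasFDerivAt_eval p x), zero_apply]

open MvPolynomial in
theorem totalDegree_pderiv_le {n : ℕ} (p : MvPolynomial (Fin n) ℝ) (i : Fin n) :
    (pderiv i p).totalDegree ≤ p.totalDegree := by
  conv_lhs => rw [p.as_sum]
  rw [map_sum]
  refine totalDegree_finsetSum_le fun s hs => ?_
  rw [pderiv_monomial]
  refine (totalDegree_monomial_le _ _).trans (le_trans ?_ (le_totalDegree hs))
  rw [Finsupp.sum_fintype _ _ (fun _ => rfl), Finsupp.sum_fintype _ _ (fun _ => rfl)]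
  exact Finset.sum_le_sum fun j _ => by simp

open MvPolynomial in
/-- The regularised system: near any near-critical point with value close to `τ` there is a
solution of the critical equation of a penalised least-squares functional. -/
theorem exists_penalised_critical {n : ℕ} (p : MvPolynomial (Fin n) ℝ) (a x₀ : Fin n → ℝ) (τ : ℝ)
    (ha : ∀ i, |a i| ≤ 1) (hx₀ : ∀ i, |x₀ i| ≤ 1) (hp : ∀ i, |eval x₀ (pderiv i p)| ≤ 1)
    (hτ : |eval x₀ p - τ| ≤ 1) :
    ∃ x : Fin n → ℝ, (∀ i, |x i| ≤ 5 * n + 2) ∧ (∀ i, |eval x (pderiv i p)| ≤ 5 * n + 1) ∧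
      |eval x p - τ| ≤ 5 * n + 1 ∧
      ∀ i, x i + ∑ j, eval x (pderiv j p) * eval x (pderiv i (pderiv j p)) +
        (eval x p - τ) * eval x (pderiv i p) = a i := by
  set Φ : MvPolynomial (Fin n) ℝ :=
    ∑ j, (pderiv j p) ^ 2 + ∑ j, (X j - C (a j)) ^ 2 + (p - C τ) ^ 2 with hΦ
  have hΦe : ∀ x, eval x Φ = ∑ j, (eval x (pderiv j p)) ^ 2 + ∑ j, (x j - a j) ^ 2 +
      (eval x p - τ) ^ 2 := fun x => by simp [hΦ]
  have hbd : ∀ x, eval x Φ ≤ eval x₀ Φ → (∀ i, |x i| ≤ 5 * n + 2) ∧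
      (∀ i, |eval x (pderiv i p)| ≤ 5 * n + 1) ∧ |eval x p - τ| ≤ 5 * n + 1 := by
    intro x hx
    have h1 : eval x₀ Φ ≤ 5 * n + 1 := by
      rw [hΦe]
      have e1 : ∑ j, (eval x₀ (pderiv j p)) ^ 2 ≤ ∑ j : Fin n, (1 : ℝ) :=
        Finset.sum_le_sum fun j _ => (sq_le_one_iff_abs_le_one _).2 (hp j)
      have e2 : ∑ j, (x₀ j - a j) ^ 2 ≤ ∑ j : Fin n, (4 : ℝ) :=
        Finset.sum_le_sum fun j _ => by
          have := abs_le.1 (ha j)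
          have := abs_le.1 (hx₀ j)
          nlinarith
      have e3 := (sq_le_one_iff_abs_le_one _).2 hτ
      simp at e1 e2
      linarith
    rw [hΦe] at hx
    have n1 : ∀ i, (eval x (pderiv i p)) ^ 2 ≤ ∑ j, (eval x (pderiv j p)) ^ 2 := fun i =>
      Finset.single_le_sum (f := fun j => (eval x (pderiv j p)) ^ 2) (fun j _ => sq_nonneg _)
        (Finset.mem_univ i)
    have n2 : ∀ i, (x i - a i) ^ 2 ≤ ∑ j, (x j - a j) ^ 2 := fun i =>
      Finset.single_le_sum (f := fun j => (x j - a j) ^ 2) (fun j _ => sq_nonneg _)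
        (Finset.mem_univ i)
    have p1 : 0 ≤ ∑ j, (eval x (pderiv j p)) ^ 2 := Finset.sum_nonneg fun j _ => sq_nonneg _
    have p2 : 0 ≤ ∑ j, (x j - a j) ^ 2 := Finset.sum_nonneg fun j _ => sq_nonneg _
    have hn : (0 : ℝ) ≤ n := n.cast_nonneg
    have key : ∀ u : ℝ, u ^ 2 ≤ 5 * n + 1 → |u| ≤ 5 * n + 1 := fun u hu =>
      abs_le_of_sq_le_sq (by nlinarith) (by positivity)
    refine ⟨fun i => ?_, fun i => key _ ?_, key _ ?_⟩
    · have := abs_le.1 (key (x i - a i) (by nlinarith [n2 i, sq_nonneg (eval x p - τ)]))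
      have := abs_le.1 (ha i)
      exact abs_le.2 ⟨by linarith, by linarith⟩
    · nlinarith [n1 i, sq_nonneg (eval x p - τ)]
    · linarith
  obtain ⟨x, hx⟩ := (continuous_eval Φ).exists_forall_le_of_isBounded x₀ (by
    refine (Metric.isBounded_closedBall (x := (0 : Fin n → ℝ)) (r := 5 * n + 2)).subset ?_
    intro x hx
    rw [mem_closedBall_zero_iff, pi_norm_le_iff_of_nonneg (by positivity)]
    exact fun i => (hbd x hx).1 i)
  refine ⟨x, (hbd x (hx x₀)).1, (hbd x (hx x₀)).2.1, (hbd x (hx x₀)).2.2, fun i => ?_⟩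
  have := eval_pderiv_eq_zero_of_isLocalExtr (p := Φ) (x := x)
    (Or.inl (Filter.Eventually.of_forall hx)) i
  simp [hΦ, Derivation.leibniz_pow, pderiv_X, Pi.single_apply,
    ← Finset.mul_sum, -Finset.sum_sub_distrib] at this
  linarith

open MvPolynomial MeasureTheory in
theorem exists_card_separated_unit_le (n D : ℕ) : ∃ K : ℕ, ∀ p : MvPolynomial (Fin n) ℝ,
    p.totalDegree ≤ D → ∀ t : Finset ℝ,
    (∀ τ ∈ t, ∃ x : Fin n → ℝ, (∀ i, |x i| ≤ 1) ∧ (∀ i, |eval x (pderiv i p)| ≤ 1) ∧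
      eval x p = τ) →
    (∀ τ ∈ t, ∀ σ ∈ t, τ ≠ σ → 2 < |τ - σ|) → t.card ≤ K := by
  obtain ⟨K, hK⟩ := exists_volume_image_cons_le n (2 * D + 1)
  refine ⟨(n + 1) * ((5 * n + 1) * (K * (5 * n + 2))), fun p hp t ht hsep => ?_⟩
  let ι : MvPolynomial (Fin n) ℝ → MvPolynomial (Fin (n + 1)) ℝ := rename Fin.succ
  have hιe : ∀ (X : Fin (n + 1) → ℝ) g, eval X (ι g) = eval (Fin.tail X) g := fun X g => by
    simp only [ι, eval_rename]; rfl
  have hιd : ∀ g, (ι g).totalDegree ≤ g.totalDegree := fun g => totalDegree_rename_le _ _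
  let q : MvPolynomial (Fin (n + 1)) ℝ := ι p - X 0
  let G : Fin n → MvPolynomial (Fin (n + 1)) ℝ := fun i =>
    X i.succ + ι (∑ j, pderiv j p * pderiv i (pderiv j p)) + X 0 * ι (pderiv i p)
  have hG : ∀ i, (G i).totalDegree ≤ 2 * D + 1 := by
    intro i
    have h1 : ∀ j, (pderiv j p).totalDegree ≤ D := fun j => (totalDegree_pderiv_le p j).trans hp
    refine (totalDegree_add _ _).trans (max_le ((totalDegree_add _ _).trans (max_le ?_ ?_)) ?_)
    · simp
    · refine (hιd _).trans (totalDegree_finsetSum_le fun j _ => (totalDegree_mul _ _).trans ?_)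
      have := (totalDegree_pderiv_le (pderiv j p) i).trans (h1 j)
      have := h1 j
      omega
    · refine (totalDegree_mul _ _).trans ?_
      have := (hιd (pderiv i p)).trans (h1 i)
      rw [totalDegree_X]
      omega
  have hGe : ∀ X i, eval X (G i) = X i.succ + ∑ j, eval (Fin.tail X) (pderiv j p) *
      eval (Fin.tail X) (pderiv i (pderiv j p)) + X 0 * eval (Fin.tail X) (pderiv i p) :=
    fun X i => by simp [G, hιe]
  have hqe : ∀ X, eval X q = eval (Fin.tail X) p - X 0 := fun X => by simp [q, hιe]
  have hq0 : ∀ X, eval X (pderiv 0 q) = -1 := by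
    intro X
    have : pderiv 0 (ι p) = 0 := by
      refine pderiv_eq_zero_of_notMem_vars fun h => ?_
      obtain ⟨i, -, hi⟩ := Finset.mem_image.1 (vars_rename Fin.succ p h)
      exact Fin.succ_ne_zero i hi
    simp [q, this]
  have hqs : ∀ X (i : Fin n), eval X (pderiv i.succ q) = eval (Fin.tail X) (pderiv i p) := by
    intro X i
    have : pderiv i.succ (ι p) = ι (pderiv i p) := pderiv_rename (Fin.succ_injective n) i p
    simp [q, this, hιe, pderiv_X, (Fin.succ_ne_zero i).symm]
  let W : Set (Fin (n + 1) → ℝ) := {X | (∀ k, |X k| ≤ 5 * n + 2) ∧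
    (∀ k, |eval X (pderiv k q)| ≤ 5 * n + 1) ∧ ∀ i, |eval X (G i)| ≤ 1}
  have hW : MeasurableSet W := by
    refine IsClosed.measurableSet ?_
    have hc : ∀ g : MvPolynomial (Fin (n + 1)) ℝ, Continuous fun x => eval x g := fun g =>
      continuous_eval g
    simp only [W, ofPred_and, ofPred_forall]
    refine (isClosed_iInter fun k => ?_).inter ((isClosed_iInter fun k => ?_).inter
      (isClosed_iInter fun k => ?_))
    · exact isClosed_le (by fun_prop) continuous_const
    · exact isClosed_le (hc _).abs continuous_const
    · exact isClosed_le (hc _).abs continuous_const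
  let I : ℝ → Set (Fin (n + 1) → ℝ) := fun τ =>
    Icc (Fin.cons (τ - 1) fun _ => -1) (Fin.cons (τ + 1) fun _ => 1)
  have hI : ∀ τ, volume (I τ) = 2 * 2 ^ n := by
    intro τ
    simp only [I, Real.volume_Icc_pi, Fin.prod_univ_succ]
    simp only [Fin.cons_zero, Fin.cons_succ, Finset.prod_const, Finset.card_univ, Fintype.card_fin]
    have e1 : τ + 1 - (τ - 1) = 2 := by ring
    have e2 : (1 : ℝ) - -1 = 2 := by ring
    rw [e1, e2]
    simp
  have hmemI : ∀ τ y, y ∈ I τ → |y 0 - τ| ≤ 1 ∧ ∀ i : Fin n, |y i.succ| ≤ 1 := by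
    rintro τ y ⟨h1, h2⟩
    constructor
    · have := h1 0
      have := h2 0
      simp only [Fin.cons_zero] at *
      exact abs_le.2 ⟨by linarith, by linarith⟩
    · intro i
      have := h1 i.succ
      have := h2 i.succ
      simp only [Fin.cons_succ] at *
      exact abs_le.2 ⟨by linarith, by linarith⟩
  have hsub : (⋃ τ ∈ t, I τ) ⊆
      (fun x i => eval x ((Fin.cons q G : Fin (n + 1) → _) i)) '' W := by
    intro y hy
    obtain ⟨τ, hτ, hyτ⟩ := mem_iUnion₂.1 hy
    obtain ⟨hy0, hys⟩ := hmemI τ y hyτ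
    obtain ⟨x₀, hx₀, hx₀', rfl⟩ := ht τ hτ
    obtain ⟨x, hx1, hx2, hx3, hx4⟩ := exists_penalised_critical p (fun i => y i.succ) x₀ (y 0)
      hys hx₀ hx₀' (by rwa [abs_sub_comm])
    refine ⟨Fin.cons (eval x p - y 0) x, ⟨fun k => ?_, fun k => ?_, fun i => ?_⟩, ?_⟩
    · refine Fin.cases ?_ (fun i => ?_) k
      · simp only [Fin.cons_zero]; linarith
      · simpa using hx1 i
    · refine Fin.cases ?_ (fun i => ?_) k
      · rw [hq0]
        have : (0 : ℝ) ≤ n := n.cast_nonneg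
        norm_num
      · simpa [hqs] using hx2 i
    · rw [hGe]
      simp only [Fin.tail_cons, Fin.cons_succ, Fin.cons_zero, hx4]
      exact hys i
    · ext i
      refine Fin.cases ?_ (fun i => ?_) i
      · simp [hqe]
      · simp [hGe, hx4]
  have hvol : volume (⋃ τ ∈ t, I τ) = t.card * (2 * 2 ^ n) := by
    rw [measure_biUnion_finset]
    · simp [hI]
    · intro τ hτ σ hσ hne
      refine disjoint_left.2 fun y h1 h2 => ?_
      have a1 := abs_le.1 (hmemI τ y h1).1
      have a2 := abs_le.1 (hmemI σ y h2).1
      rcases lt_abs.1 (hsep τ hτ σ hσ hne) with h | h <;> linarith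
    · exact fun τ _ => measurableSet_Icc
  have hfin := (measure_mono hsub).trans
    (hK q G hG (5 * n + 1) (5 * n + 2) W (by positivity) hW fun x hx => hx)
  rw [hvol] at hfin
  have e0 : ENNReal.ofReal (5 * n + 1) = ((5 * n + 1 : ℕ) : ENNReal) := by
    rw [← ENNReal.ofReal_natCast]; push_cast; rfl
  have e1 : ENNReal.ofReal (2 * (5 * n + 2)) = ((2 * (5 * n + 2) : ℕ) : ENNReal) := by
    rw [← ENNReal.ofReal_natCast]; push_cast; rfl
  rw [e0, e1] at hfin
  have hfin' : t.card * (2 * 2 ^ n) ≤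
      (n + 1) * ((5 * n + 1) * (K * ((2 * (5 * n + 2)) * 2 ^ n))) := by exact_mod_cast hfin
  have : 0 < 2 * 2 ^ n := by positivity
  refine Nat.le_of_mul_le_mul_right (hfin'.trans (le_of_eq ?_)) this
  ring

theorem exists_cover_of_card_separated_le {S : Set ℝ} {δ : ℝ} {K : ℕ} (hδ : 0 ≤ δ)
    (h : ∀ t : Finset ℝ, ↑t ⊆ S → (∀ τ ∈ t, ∀ σ ∈ t, τ ≠ σ → δ < |τ - σ|) → t.card ≤ K) :
    ∃ t : Finset ℝ, t.card ≤ K ∧ S ⊆ ⋃ c ∈ t, closedBall c δ := by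
  classical
  by_contra! hc
  have : ∀ k, k ≤ K + 1 → ∃ t : Finset ℝ, ↑t ⊆ S ∧
      (∀ τ ∈ t, ∀ σ ∈ t, τ ≠ σ → δ < |τ - σ|) ∧ t.card = k := by
    intro k
    induction k with
    | zero => exact fun _ => ⟨∅, by simp⟩
    | succ k ih =>
      intro hk
      obtain ⟨t, htS, hsep, hcard⟩ := ih (by omega)
      obtain ⟨x, hxS, hx⟩ := not_subset.1 (hc t (by omega))
      simp only [mem_iUnion, mem_closedBall, not_exists, not_le, Real.dist_eq] at hx
      have hxt : x ∉ t := fun hxt => by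
        have := hx x hxt
        simp at this
        linarith
      refine ⟨insert x t, ?_, ?_, by rw [Finset.card_insert_of_notMem hxt, hcard]⟩
      · rw [Finset.coe_insert]
        exact insert_subset hxS htS
      · intro τ hτ σ hσ hne
        rw [Finset.mem_insert] at hτ hσ
        rcases hτ with rfl | hτ <;> rcases hσ with rfl | hσ
        · exact absurd rfl hne
        · exact hx σ hσ
        · rw [abs_sub_comm]; exact hx τ hτ
        · exact hsep τ hτ σ hσ hne
  obtain ⟨t, htS, hsep, hcard⟩ := this (K + 1) le_rfl
  have := h t htS hsep
  omega

open MvPolynomial in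
theorem totalDegree_bind₁_le {n m : ℕ} (p : MvPolynomial (Fin n) ℝ)
    (g : Fin n → MvPolynomial (Fin m) ℝ) (hg : ∀ i, (g i).totalDegree ≤ 1) :
    (bind₁ g p).totalDegree ≤ p.totalDegree := by
  conv_lhs => rw [p.as_sum]
  rw [map_sum]
  refine totalDegree_finsetSum_le fun s hs => ?_
  rw [bind₁_monomial]
  refine (totalDegree_mul _ _).trans ?_
  rw [totalDegree_C, zero_add]
  refine (totalDegree_finsetProd _ _).trans (le_trans ?_ (le_totalDegree hs))
  refine Finset.sum_le_sum fun i _ => (totalDegree_pow _ _).trans ?_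
  simpa using Nat.mul_le_mul_left (s i) (hg i)

open MvPolynomial in
theorem exists_card_separated_le (n D : ℕ) : ∃ K : ℕ, ∀ p : MvPolynomial (Fin n) ℝ,
    p.totalDegree ≤ D → ∀ (x₀ : Fin n → ℝ) (ρ l : ℝ), 0 < ρ → 0 < l → ∀ t : Finset ℝ,
    (∀ τ ∈ t, ∃ x : Fin n → ℝ, (∀ i, |x i - x₀ i| ≤ ρ) ∧ (∀ i, |eval x (pderiv i p)| ≤ l) ∧
      eval x p = τ) →
    (∀ τ ∈ t, ∀ σ ∈ t, τ ≠ σ → 2 * l * ρ < |τ - σ|) → t.card ≤ K := by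
  obtain ⟨K, hK⟩ := exists_card_separated_unit_le n D
  refine ⟨K, fun p hp x₀ ρ l hρ hl t ht hsep => ?_⟩
  let q : MvPolynomial (Fin n) ℝ := C (l * ρ)⁻¹ * bind₁ (fun i => C (x₀ i) + C ρ * X i) p
  have hlρ : 0 < l * ρ := mul_pos hl hρ
  have hq : q.totalDegree ≤ D := by
    refine (totalDegree_mul _ _).trans ?_
    rw [totalDegree_C, zero_add]
    refine (totalDegree_bind₁_le p _ fun i => ?_).trans hp
    refine (totalDegree_add _ _).trans (max_le (by simp) ((totalDegree_mul _ _).trans ?_))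
    simp
  have hqe : ∀ y, eval y q = (l * ρ)⁻¹ * eval (x₀ + ρ • y) p := by
    intro y
    simp only [q, map_mul, eval_C]
    rw [← coe_aeval_eq_eval, ← coe_aeval_eq_eval, RingHom.coe_coe, RingHom.coe_coe, aeval_bind₁]
    congr 3
    ext i
    simp
  have hqd : ∀ y i, eval y (pderiv i q) = l⁻¹ * eval (x₀ + ρ • y) (pderiv i p) := by
    intro y i
    have h1 := (hasFDerivAt_eval p (x₀ + ρ • y)).comp y
      (((hasFDerivAt_id y).const_smul ρ).const_add x₀)
    have h2 := h1.const_mul (l * ρ)⁻¹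
    have h3 : HasFDerivAt (fun y => eval y q) _ y := h2.congr_of_eventuallyEq
      (Filter.Eventually.of_forall fun y => hqe y)
    rw [eval_pderiv_eq_of_hasFDerivAt h3]
    simp [Pi.single_apply]
    field_simp
  let e : ℝ ↪ ℝ := ⟨fun τ => (l * ρ)⁻¹ * τ, fun a b h => by
    simpa [hρ.ne', hl.ne'] using h⟩
  rw [← Finset.card_map e]
  refine hK q hq _ ?_ ?_
  · intro τ hτ
    obtain ⟨σ, hσ, rfl⟩ := Finset.mem_map.1 hτ
    obtain ⟨x, hx1, hx2, rfl⟩ := ht σ hσ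
    have hx : x₀ + ρ • (ρ⁻¹ • (x - x₀)) = x := by
      rw [smul_smul, mul_inv_cancel₀ hρ.ne', one_smul]; abel
    refine ⟨ρ⁻¹ • (x - x₀), fun i => ?_, fun i => ?_, ?_⟩
    · simp only [Pi.smul_apply, Pi.sub_apply, smul_eq_mul, abs_mul, abs_inv, abs_of_pos hρ]
      rw [inv_mul_le_iff₀ hρ, mul_one]
      exact hx1 i
    · rw [hqd, hx, abs_mul, abs_inv, abs_of_pos hl, inv_mul_le_iff₀ hl, mul_one]
      exact hx2 i
    · rw [hqe, hx]; rfl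
  · intro τ hτ σ hσ hne
    obtain ⟨τ, hτ', rfl⟩ := Finset.mem_map.1 hτ
    obtain ⟨σ, hσ', rfl⟩ := Finset.mem_map.1 hσ
    have := hsep τ hτ' σ hσ' fun h => hne (by rw [h])
    change 2 < |(l * ρ)⁻¹ * τ - (l * ρ)⁻¹ * σ|
    rw [← mul_sub, abs_mul, abs_inv, abs_of_pos hlρ, lt_inv_mul_iff₀ hlρ]
    linarith

open MvPolynomial in
theorem exists_cover_near_critical_values (n D : ℕ) : ∃ K : ℕ, ∀ p : MvPolynomial (Fin n) ℝ,
    p.totalDegree ≤ D → ∀ (x₀ : Fin n → ℝ) (ρ l : ℝ), 0 < ρ → 0 < l →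
    ∃ t : Finset ℝ, t.card ≤ K ∧ ∀ x : Fin n → ℝ, (∀ i, |x i - x₀ i| ≤ ρ) →
      (∀ i, |eval x (pderiv i p)| ≤ l) → ∃ c ∈ t, |eval x p - c| ≤ 2 * l * ρ := by
  obtain ⟨K, hK⟩ := exists_card_separated_le n D
  refine ⟨K, fun p hp x₀ ρ l hρ hl => ?_⟩
  obtain ⟨t, ht, hcov⟩ := exists_cover_of_card_separated_le (K := K) (δ := 2 * l * ρ) (by positivity)
    (S := {τ | ∃ x : Fin n → ℝ, (∀ i, |x i - x₀ i| ≤ ρ) ∧ (∀ i, |eval x (pderiv i p)| ≤ l) ∧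
      eval x p = τ}) fun t hsub hsep => hK p hp x₀ ρ l hρ hl t (fun τ hτ => hsub hτ) hsep
  refine ⟨t, ht, fun x h1 h2 => ?_⟩
  simpa [Real.dist_eq] using hcov ⟨x, h1, h2, rfl⟩

open MvPolynomial in
theorem exists_card_critical_values_le (n D : ℕ) : ∃ K : ℕ, ∀ p : MvPolynomial (Fin n) ℝ,
    p.totalDegree ≤ D → ∀ t : Finset ℝ,
    (∀ τ ∈ t, ∃ x : Fin n → ℝ, (∀ i, eval x (pderiv i p) = 0) ∧ eval x p = τ) → t.card ≤ K := by
  obtain ⟨K, hK⟩ := exists_card_separated_le n D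
  refine ⟨max K 1, fun p hp t ht => ?_⟩
  by_cases htn : (t : Set ℝ).Nontrivial
  · choose! x hx hxe using ht
    have hs : 0 < (t : Set ℝ).infsep := t.finite_toSet.infsep_pos_iff_nontrivial.2 htn
    set ρ : ℝ := 1 + ∑ τ ∈ t, ‖x τ‖ with hρdef
    have hρ : 0 < ρ := by positivity
    refine (hK p hp 0 ρ ((t : Set ℝ).infsep / (4 * ρ)) hρ (by positivity) t ?_ ?_).trans
      (le_max_left _ _)
    · intro τ hτ
      refine ⟨x τ, fun i => ?_, fun i => ?_, hxe τ hτ⟩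
      · have h1 := Finset.single_le_sum (f := fun τ => ‖x τ‖) (fun σ _ => norm_nonneg _) hτ
        have h2 := norm_le_pi_norm (x τ) i
        rw [Real.norm_eq_abs] at h2
        simp only [Pi.zero_apply, sub_zero]
        linarith
      · rw [hx τ hτ i, abs_zero]; positivity
    · intro τ hτ σ hσ hne
      have := Set.infsep_le_dist_of_mem (s := (t : Set ℝ)) hτ hσ hne
      rw [Real.dist_eq] at this
      have e : 2 * ((t : Set ℝ).infsep / (4 * ρ)) * ρ = (t : Set ℝ).infsep / 2 := by
        field_simp; ring
      linarith
  · refine le_trans ?_ (le_max_right _ _)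
    rw [Set.not_nontrivial_iff] at htn
    exact Finset.card_le_one_iff_subsingleton.2 htn

/-- The homogeneous Taylor term `D^j f(x₀)(v, …, v)`, with derivatives taken within `s`. -/
noncomputable def taylorTerm {E : Type} [NormedAddCommGroup E] [NormedSpace ℝ E] (s : Set E)
    (x₀ : E) : ∀ (_ : ℕ) {F : Type} [NormedAddCommGroup F] [NormedSpace ℝ F], (E → F) → E → F
  | 0, _, _, _, f, _ => f x₀
  | j + 1, _, _, _, f, v => taylorTerm s x₀ j (fderivWithin ℝ f s) v v

section

variable {E : Type} [NormedAddCommGroup E] [NormedSpace ℝ E] {s : Set E} {x₀ : E}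

theorem taylorTerm_congr (hx₀ : x₀ ∈ s) (j : ℕ) {F : Type} [NormedAddCommGroup F]
    [NormedSpace ℝ F] {f g : E → F} (h : EqOn f g s) (v : E) :
    taylorTerm s x₀ j f v = taylorTerm s x₀ j g v := by
  induction j generalizing F with
  | zero => exact h hx₀
  | succ j ih =>
    simp only [taylorTerm]
    rw [ih fun x hx => fderivWithin_congr h (h hx)]

theorem taylorTerm_comp_left (hs : UniqueDiffOn ℝ s) (hx₀ : x₀ ∈ s) (j : ℕ) {F G : Type}
    [NormedAddCommGroup F] [NormedSpace ℝ F] [NormedAddCommGroup G] [NormedSpace ℝ G] (L : F →L[ℝ] G)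
    {f : E → F} (hf : ContDiffOn ℝ j f s) (v : E) :
    taylorTerm s x₀ j (fun x => L (f x)) v = L (taylorTerm s x₀ j f v) := by
  induction j generalizing F G with
  | zero => rfl
  | succ j ih =>
    simp only [taylorTerm]
    have h1 : EqOn (fderivWithin ℝ (fun x => L (f x)) s)
        (fun x => ContinuousLinearMap.compL ℝ E F G L (fderivWithin ℝ f s x)) s := fun x hx =>
      (L.hasFDerivAt.comp_hasFDerivWithinAt x
        ((hf.differentiableOn (by simp)) x hx).hasFDerivWithinAt).fderivWithin (hs x hx)
    rw [taylorTerm_congr hx₀ j h1, ih _ (hf.fderivWithin hs (by norm_cast))]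
    rfl

theorem hasFDerivAt_taylorTerm (hs : UniqueDiffOn ℝ s) (hsc : s ⊆ closure (interior s))
    (hx₀ : x₀ ∈ s) (j : ℕ) {F : Type} [NormedAddCommGroup F] [NormedSpace ℝ F] {f : E → F}
    (hf : ContDiffOn ℝ (j + 1 : ℕ) f s) (v : E) :
    HasFDerivAt (taylorTerm s x₀ (j + 1) f)
      (((j : ℝ) + 1) • taylorTerm s x₀ j (fderivWithin ℝ f s) v) v := by
  induction j generalizing F with
  | zero =>
    simp only [taylorTerm, Nat.cast_zero, zero_add, one_smul]
    exact (fderivWithin ℝ f s x₀).hasFDerivAt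
  | succ j ih =>
    have hf' : ContDiffOn ℝ (j + 1 : ℕ) (fderivWithin ℝ f s) s :=
      hf.fderivWithin hs (by norm_cast)
    have hf'' : ContDiffOn ℝ j (fderivWithin ℝ (fderivWithin ℝ f s) s) s :=
      hf'.fderivWithin hs (by norm_cast)
    have h1 : HasFDerivAt (taylorTerm s x₀ (j + 1 + 1) f) _ v := (ih hf').clm_apply (hasFDerivAt_id v)
    refine h1.congr_fderiv ?_
    let L := (ContinuousLinearMap.flipₗᵢ ℝ E E F).toContinuousLinearEquiv.toContinuousLinearMap
    have hsym : EqOn (fderivWithin ℝ (fderivWithin ℝ f s) s)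
        (fun x => L (fderivWithin ℝ (fderivWithin ℝ f s) s x)) s := by
      intro x hx
      ext a b
      have := (hf x hx).isSymmSndFDerivWithinAt (by
        simp only [minSmoothness_of_isRCLikeNormedField]; norm_cast; omega) hs (hsc hx) hx
      exact this a b
    have h2 : taylorTerm s x₀ j (fderivWithin ℝ (fderivWithin ℝ f s) s) v =
        L (taylorTerm s x₀ j (fderivWithin ℝ (fderivWithin ℝ f s) s) v) :=
      (taylorTerm_congr hx₀ j hsym v).trans (taylorTerm_comp_left hs hx₀ j
        (F := E →L[ℝ] E →L[ℝ] F) (G := E →L[ℝ] E →L[ℝ] F) L hf'' v)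
    ext u
    have h3 : taylorTerm s x₀ j (fderivWithin ℝ (fderivWithin ℝ f s) s) v u v =
        taylorTerm s x₀ j (fderivWithin ℝ (fderivWithin ℝ f s) s) v v u := by
      conv_lhs => rw [h2]
      rfl
    simp [taylorTerm, h3]
    module

/-- The Taylor polynomial of order `d` (exclusive) of `f` at `x₀`, within `s`. -/
noncomputable def taylorSum (s : Set E) (x₀ : E) (d : ℕ) {F : Type} [NormedAddCommGroup F]
    [NormedSpace ℝ F] (f : E → F) (v : E) : F :=
  ∑ j ∈ Finset.range d, ((j.factorial : ℝ)⁻¹) • taylorTerm s x₀ j f v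

theorem hasFDerivAt_taylorSum (hs : UniqueDiffOn ℝ s) (hsc : s ⊆ closure (interior s))
    (hx₀ : x₀ ∈ s) (d : ℕ) {F : Type} [NormedAddCommGroup F] [NormedSpace ℝ F] {f : E → F}
    (hf : ContDiffOn ℝ d f s) (v : E) :
    HasFDerivAt (taylorSum s x₀ (d + 1) f) (taylorSum s x₀ d (fderivWithin ℝ f s) v) v := by
  have h : HasFDerivAt (fun v => ∑ j ∈ Finset.range d,
      (((j + 1).factorial : ℝ)⁻¹) • taylorTerm s x₀ (j + 1) f v + f x₀)
      (∑ j ∈ Finset.range d, (((j + 1).factorial : ℝ)⁻¹) •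
        (((j : ℝ) + 1) • taylorTerm s x₀ j (fderivWithin ℝ f s) v)) v := by
    refine (HasFDerivAt.fun_sum fun j hj => ?_).add_const _
    refine (hasFDerivAt_taylorTerm hs hsc hx₀ j (hf.of_le ?_) v).const_smul _
    have := Finset.mem_range.1 hj
    exact_mod_cast this
  refine (h.congr_fderiv ?_).congr_of_eventuallyEq (Filter.Eventually.of_forall fun v => ?_)
  · refine Finset.sum_congr rfl fun j _ => ?_
    rw [smul_smul]
    congr 1
    rw [Nat.factorial_succ]
    push_cast
    have : (j.factorial : ℝ) ≠ 0 := by positivity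
    field_simp
  · rw [taylorSum, Finset.sum_range_succ']
    simp [taylorTerm]

theorem taylorSum_zero (d : ℕ) {F : Type} [NormedAddCommGroup F] [NormedSpace ℝ F] (f : E → F) :
    taylorSum s x₀ (d + 1) f 0 = f x₀ := by
  rw [taylorSum, Finset.sum_range_succ']
  simp [taylorTerm]

theorem norm_sub_taylorSum_le (hs : UniqueDiffOn ℝ s) (hsc : s ⊆ closure (interior s))
    (hconv : Convex ℝ s) (hx₀ : x₀ ∈ s) (d : ℕ) {F : Type} [NormedAddCommGroup F] [NormedSpace ℝ F]
    {f : E → F} (hf : ContDiffOn ℝ d f s) {M : ℝ}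
    (hM : ∀ x ∈ s, ‖iteratedFDerivWithin ℝ d f s x‖ ≤ M) {x : E} (hx : x ∈ s) :
    ‖f x - taylorSum s x₀ d f (x - x₀)‖ ≤ M * ‖x - x₀‖ ^ d := by
  induction d generalizing F x with
  | zero => simpa [taylorSum] using hM x hx
  | succ d ih =>
    have hf' : ContDiffOn ℝ d (fderivWithin ℝ f s) s := hf.fderivWithin hs (by norm_cast)
    have hM0 : 0 ≤ M := (norm_nonneg _).trans (hM x hx)
    have hd : ∀ y ∈ s, HasFDerivWithinAt (fun y => f y - taylorSum s x₀ (d + 1) f (y - x₀))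
        (fderivWithin ℝ f s y - taylorSum s x₀ d (fderivWithin ℝ f s) (y - x₀)) s y := by
      intro y hy
      refine ((hf.differentiableOn (by simp)) y hy).hasFDerivWithinAt.sub ?_
      have := (hasFDerivAt_taylorSum hs hsc hx₀ d (hf.of_le (by norm_cast; omega)) (y - x₀)).comp y
        ((hasFDerivAt_id y).sub_const x₀)
      exact this.hasFDerivWithinAt
    have := (hconv.inter (convex_closedBall x₀ ‖x - x₀‖)).norm_image_sub_le_of_norm_hasFDerivWithin_le
      (C := M * ‖x - x₀‖ ^ d) (fun y hy => (hd y hy.1).mono inter_subset_left) (fun y hy => ?_)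
      (x := x₀) (y := x) ⟨hx₀, by simp⟩ ⟨hx, by simp [dist_eq_norm]⟩
    · simpa [taylorSum_zero, pow_succ, mul_assoc] using this
    · refine (ih hf' (fun z hz => ?_) hy.1).trans ?_
      · rw [norm_iteratedFDerivWithin_fderivWithin hs hz]
        exact hM z hz
      · have := hy.2
        rw [mem_closedBall, dist_eq_norm] at this
        gcongr

end

open MvPolynomial in
theorem exists_eval_eq_taylorTerm {n : ℕ} {s : Set (EuclideanSpace ℝ (Fin n))}
    {x₀ : EuclideanSpace ℝ (Fin n)} (j : ℕ) {F : Type} [NormedAddCommGroup F] [NormedSpace ℝ F]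
    (f : EuclideanSpace ℝ (Fin n) → F) (L : F →L[ℝ] ℝ) :
    ∃ P : MvPolynomial (Fin n) ℝ, P.totalDegree ≤ j ∧
      ∀ v, eval v.ofLp P = L (taylorTerm s x₀ j f v) := by
  induction j generalizing F with
  | zero => exact ⟨C (L (f x₀)), by simp, fun v => by simp [taylorTerm]⟩
  | succ j ih =>
    choose P hP hPe using fun i : Fin n => ih (fderivWithin ℝ f s)
      (L.comp (ContinuousLinearMap.apply ℝ F (EuclideanSpace.single i (1 : ℝ))))
    refine ⟨∑ i, X i * P i, totalDegree_finsetSum_le fun i _ => ?_, fun v => ?_⟩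
    · refine (totalDegree_mul _ _).trans ?_
      have := hP i
      rw [totalDegree_X]
      omega
    · have hv : v = ∑ i, v i • EuclideanSpace.single i (1 : ℝ) := by
        ext k
        simp [Pi.single_apply]
      simp only [map_sum, map_mul, eval_X, hPe, taylorTerm]
      conv_rhs => arg 2; arg 2; rw [hv]
      simp

open MvPolynomial in
theorem exists_taylor_polynomial {n d : ℕ} {s : Set (EuclideanSpace ℝ (Fin n))}
    {x₀ : EuclideanSpace ℝ (Fin n)} (hs : UniqueDiffOn ℝ s) (hsc : s ⊆ closure (interior s))
    (hconv : Convex ℝ s) (hx₀ : x₀ ∈ s) {f : EuclideanSpace ℝ (Fin n) → ℝ}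
    (hf : ContDiffOn ℝ (d + 1 : ℕ) f s) {M : ℝ}
    (hM : ∀ x ∈ s, ‖iteratedFDerivWithin ℝ (d + 1) f s x‖ ≤ M) :
    ∃ P : MvPolynomial (Fin n) ℝ, P.totalDegree ≤ d ∧ ∀ x ∈ s,
      |f x - eval (x - x₀).ofLp P| ≤ M * ‖x - x₀‖ ^ (d + 1) ∧
      ∀ i, |fderivWithin ℝ f s x (EuclideanSpace.single i 1) -
        eval (x - x₀).ofLp (pderiv i P)| ≤ M * ‖x - x₀‖ ^ d := by
  choose P hP hPe using fun j : ℕ => exists_eval_eq_taylorTerm (s := s) (x₀ := x₀) j f (.id ℝ ℝ)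
  let Q : MvPolynomial (Fin n) ℝ := ∑ j ∈ Finset.range (d + 1), C ((j.factorial : ℝ)⁻¹) * P j
  have hQe : ∀ v : EuclideanSpace ℝ (Fin n), eval v.ofLp Q = taylorSum s x₀ (d + 1) f v :=
    fun v => by simp [Q, taylorSum, hPe]
  refine ⟨Q, totalDegree_finsetSum_le fun j hj => ?_, fun x hx => ⟨?_, fun i => ?_⟩⟩
  · refine (totalDegree_mul _ _).trans ?_
    have := hP j
    have := Finset.mem_range.1 hj
    rw [totalDegree_C]
    omega
  · rw [hQe]
    exact norm_sub_taylorSum_le hs hsc hconv hx₀ (d + 1) hf hM hx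
  · have h1 := hasFDerivAt_taylorSum hs hsc hx₀ d (hf.of_le (by norm_cast; omega)) (x - x₀)
    have h2 : HasFDerivAt (fun v : Fin n → ℝ => eval v Q) _ (x - x₀).ofLp :=
      (HasFDerivAt.comp (x - x₀).ofLp (g := taylorSum s x₀ (d + 1) f) h1
        (PiLp.continuousLinearEquiv 2 ℝ fun _ : Fin n => ℝ).symm.hasFDerivAt).congr_of_eventuallyEq
        (Filter.Eventually.of_forall fun v => hQe (WithLp.toLp 2 v))
    rw [eval_pderiv_eq_of_hasFDerivAt h2]
    have h3 := norm_sub_taylorSum_le hs hsc hconv hx₀ d (f := fderivWithin ℝ f s) (M := M)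
      (hf.fderivWithin hs (by norm_cast)) (fun z hz => by
        rw [norm_iteratedFDerivWithin_fderivWithin hs hz]
        exact hM z hz) hx
    have h4 := (fderivWithin ℝ f s x - taylorSum s x₀ d (fderivWithin ℝ f s) (x - x₀)).le_opNorm
      (EuclideanSpace.single i 1)
    simp only [PiLp.norm_single, norm_one, mul_one] at h4
    exact h4.trans h3

open MvPolynomial in
theorem hasStrictFDerivAt_eval {m : ℕ} (P : MvPolynomial (Fin m) ℝ) (x : Fin m → ℝ) :
    HasStrictFDerivAt (fun x => eval x P)
      (∑ i, eval x (pderiv i P) • ContinuousLinearMap.proj (R := ℝ) (φ := fun _ => ℝ) i) x := by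
  refine hasStrictFDerivAt_of_hasFDerivAt_of_continuousAt
    (Filter.Eventually.of_forall fun y => hasFDerivAt_eval P y) (Continuous.continuousAt ?_)
  exact continuous_finsetSum _ fun i _ => (continuous_eval _).smul continuous_const

open MvPolynomial in
theorem exists_card_isLocalMinOn_ball_values_le (n D : ℕ) : ∃ K : ℕ,
    ∀ h : MvPolynomial (Fin n) ℝ, h.totalDegree ≤ D → ∀ r : ℝ, 0 < r → ∀ t : Finset ℝ,
    (∀ τ ∈ t, ∃ y : Fin n → ℝ, ∑ i, y i ^ 2 ≤ r ^ 2 ∧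
      IsLocalMinOn (fun x => eval x h) {x | ∑ i, x i ^ 2 ≤ r ^ 2} y ∧ eval y h = τ) →
    t.card ≤ K := by
  classical
  obtain ⟨K₁, hK₁⟩ := exists_card_critical_values_le n D
  obtain ⟨K₂, hK₂⟩ := exists_card_critical_values_le (n + 1) (max D 3)
  refine ⟨K₁ + K₂, fun h hh r hr t ht => ?_⟩
  let N : MvPolynomial (Fin n) ℝ := ∑ i, X i ^ 2
  have hNe : ∀ x, eval x N = ∑ i, x i ^ 2 := fun x => by simp [N]
  have hNd : ∀ x i, eval x (pderiv i N) = 2 * x i := fun x i => by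
    simp [N, Derivation.leibniz_pow, pderiv_X, Pi.single_apply]
  let ι : MvPolynomial (Fin n) ℝ → MvPolynomial (Fin (n + 1)) ℝ := rename Fin.succ
  have hιe : ∀ (X : Fin (n + 1) → ℝ) g, eval X (ι g) = eval (Fin.tail X) g := fun X g => by
    simp only [ι, eval_rename]; rfl
  have hι0 : ∀ g, pderiv 0 (ι g) = 0 := fun g => by
    refine pderiv_eq_zero_of_notMem_vars fun h => ?_
    obtain ⟨i, -, hi⟩ := Finset.mem_image.1 (vars_rename Fin.succ g h)
    exact Fin.succ_ne_zero i hi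
  have hιs : ∀ g (i : Fin n), pderiv i.succ (ι g) = ι (pderiv i g) := fun g i =>
    pderiv_rename (Fin.succ_injective n) i g
  let H : MvPolynomial (Fin (n + 1)) ℝ := ι h + X 0 * (ι N - C (r ^ 2))
  have hH : H.totalDegree ≤ max D 3 := by
    refine (totalDegree_add _ _).trans (max_le ?_ ?_)
    · exact (totalDegree_rename_le _ _).trans (hh.trans (le_max_left _ _))
    · refine (totalDegree_mul _ _).trans (le_trans ?_ (le_max_right _ _))
      have h1 : (ι N - C (r ^ 2)).totalDegree ≤ 2 := by
        refine (totalDegree_sub_C_le _ _).trans ((totalDegree_rename_le _ _).trans ?_)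
        exact totalDegree_finsetSum_le fun i _ => by simp
      rw [totalDegree_X]
      omega
  have key : ∀ τ ∈ t, (∃ x : Fin n → ℝ, (∀ i, eval x (pderiv i h) = 0) ∧ eval x h = τ) ∨
      ∃ x : Fin (n + 1) → ℝ, (∀ i, eval x (pderiv i H) = 0) ∧ eval x H = τ := by
    intro τ hτ
    obtain ⟨y, hyr, hmin, rfl⟩ := ht τ hτ
    rcases hyr.lt_or_eq with hlt | heq
    · left
      refine ⟨y, eval_pderiv_eq_zero_of_isLocalExtr (Or.inl (hmin.isLocalMin ?_)), rfl⟩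
      have : IsOpen {x : Fin n → ℝ | ∑ i, x i ^ 2 < r ^ 2} :=
        isOpen_lt (by fun_prop) continuous_const
      exact Filter.mem_of_superset (this.mem_nhds hlt) fun x hx =>
        (show ∑ i, x i ^ 2 < r ^ 2 from hx).le
    · right
      have hmin' : IsLocalMinOn (fun x => eval x h) {x | eval x N = eval y N} y :=
        hmin.on_subset fun x hx => by
          rw [mem_ofPred_eq, hNe, hNe] at hx
          exact (hx.trans heq).le
      obtain ⟨a, b, hab, hsum⟩ := IsLocalExtrOn.exists_multipliers_of_hasStrictFDerivAt_1d
        (Or.inl hmin') (hasStrictFDerivAt_eval N y) (hasStrictFDerivAt_eval h y)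
      have hc : ∀ i, a * (2 * y i) + b * eval y (pderiv i h) = 0 := by
        intro i
        have := congrArg (fun L => L (Pi.single i 1)) hsum
        simpa [Pi.single_apply, hNd] using this
      have hb : b ≠ 0 := by
        rintro rfl
        have ha : a ≠ 0 := fun ha => hab (by simp [ha])
        have hy : ∀ i, y i = 0 := fun i => by simpa [ha] using hc i
        simp [hy] at heq
        exact (pow_ne_zero 2 hr.ne') heq.symm
      refine ⟨Fin.cons (a / b) y, fun i => ?_, ?_⟩
      · refine Fin.cases ?_ (fun i => ?_) i
        · simp [H, hι0, hιe, hNe, heq]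
        · have := hc i
          simp [H, hιs, hιe, hNd]
          field_simp
          linarith
      · simp [H, hιe, hNe, heq]
  set p : ℝ → Prop := fun τ => ∃ x : Fin n → ℝ, (∀ i, eval x (pderiv i h) = 0) ∧ eval x h = τ
  rw [← Finset.card_filter_add_card_filter_not p]
  refine add_le_add (hK₁ h hh _ fun τ hτ => (Finset.mem_filter.1 hτ).2) (hK₂ H hH _ fun τ hτ => ?_)
  exact (key τ (Finset.mem_filter.1 hτ).1).resolve_left (Finset.mem_filter.1 hτ).2

open MvPolynomial MeasureTheory in
theorem eq_C_of_eqOn_isOpen {n : ℕ} {P : MvPolynomial (Fin n) ℝ} {U : Set (Fin n → ℝ)}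
    (hU : IsOpen U) (hne : U.Nonempty) {c : ℝ} (h : ∀ x ∈ U, eval x P = c) : P = C c := by
  by_contra hP
  have h1 := ae_eval_ne_zero n (P - C c) (sub_ne_zero.2 hP)
  have h2 : volume U = 0 := measure_mono_null (fun x hx => by simp [h x hx]) h1
  exact (hU.measure_pos volume hne).ne' h2

open MvPolynomial in
/-- If a polynomial has finitely many near-critical values in a ball, one of which is attained where
the gradient is strictly smaller than the threshold, then it is constant. -/
theorem subsingleton_near_critical_values {n : ℕ} {P : MvPolynomial (Fin n) ℝ} {r l : ℝ} (hr : 0 < r)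
    (hfin : ((fun x => eval x P) '' {x | ∑ i, x i ^ 2 ≤ r ^ 2 ∧
      ∑ i, eval x (pderiv i P) ^ 2 ≤ l ^ 2}).Finite) {y : Fin n → ℝ} (hy : ∑ i, y i ^ 2 ≤ r ^ 2)
    (hyl : ∑ i, eval y (pderiv i P) ^ 2 < l ^ 2) : ∃ c, P = C c := by
  have hc : ∀ g : MvPolynomial (Fin n) ℝ, Continuous fun x => eval x g := fun g => continuous_eval g
  have hopen : IsOpen {x : Fin n → ℝ | ∑ i, eval x (pderiv i P) ^ 2 < l ^ 2} :=
    isOpen_lt (continuous_finsetSum _ fun i _ => (hc _).pow 2) continuous_const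
  have hopen' : IsOpen {x : Fin n → ℝ | ∑ i, x i ^ 2 < r ^ 2} :=
    isOpen_lt (by fun_prop) continuous_const
  obtain ⟨z, hz⟩ : ∃ z : Fin n → ℝ, ∑ i, z i ^ 2 < r ^ 2 ∧
      ∑ i, eval z (pderiv i P) ^ 2 < l ^ 2 := by
    have hcont : ContinuousAt (fun a : ℝ => a • y) 1 := by fun_prop
    have h1 := hcont.eventually (p := fun x => ∑ i, eval x (pderiv i P) ^ 2 < l ^ 2)
      (by simp only [one_smul]; exact hopen.mem_nhds hyl)
    have h2 : ∀ᶠ a in nhdsWithin (1 : ℝ) (Iio 1), 0 < a ∧ a < 1 :=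
      Filter.Eventually.and (mem_nhdsWithin_of_mem_nhds (lt_mem_nhds one_pos)) self_mem_nhdsWithin
    obtain ⟨a, ha, ha0, ha1⟩ := ((h1.filter_mono nhdsWithin_le_nhds).and h2).exists
    refine ⟨a • y, ?_, ha⟩
    simp only [Pi.smul_apply, smul_eq_mul, mul_pow, ← Finset.mul_sum]
    have : a ^ 2 < 1 := by nlinarith
    have hr2 : 0 < r ^ 2 := by positivity
    have : a ^ 2 * ∑ i, y i ^ 2 ≤ a ^ 2 * r ^ 2 := by gcongr
    nlinarith
  obtain ⟨η, hη, hball⟩ := Metric.isOpen_iff.1 (hopen'.inter hopen) z hz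
  refine ⟨eval z P, eq_C_of_eqOn_isOpen isOpen_ball ⟨z, mem_ball_self hη⟩ fun x hx => ?_⟩
  have hconn : IsPreconnected ((fun x => eval x P) '' ball z η) :=
    (convex_ball z η).isPreconnected.image _ (hc P).continuousOn
  have hfin' : ((fun x => eval x P) '' ball z η).Finite :=
    hfin.subset (image_mono fun x hx => ⟨le_of_lt (hball hx).1, le_of_lt (hball hx).2⟩)
  by_contra hne
  have hx' := mem_image_of_mem (fun x => eval x P) hx
  have hz' := mem_image_of_mem (fun x => eval x P) (mem_ball_self (x := z) hη)
  rcases lt_or_gt_of_ne hne with h | h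
  · exact Icc_infinite h (hfin'.subset (hconn.Icc_subset hx' hz'))
  · exact Icc_infinite h (hfin'.subset (hconn.Icc_subset hz' hx'))

theorem isCompact_sum_sq_le (n : ℕ) (r : ℝ) : IsCompact {x : Fin n → ℝ | ∑ i, x i ^ 2 ≤ r ^ 2} := by
  refine Metric.isCompact_of_isClosed_isBounded (isClosed_le (by fun_prop) continuous_const) ?_
  refine (Metric.isBounded_closedBall (x := (0 : Fin n → ℝ)) (r := |r|)).subset fun x hx => ?_
  rw [mem_closedBall_zero_iff, pi_norm_le_iff_of_nonneg (abs_nonneg r)]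
  intro i
  rw [Real.norm_eq_abs, ← sq_le_sq]
  exact (Finset.single_le_sum (f := fun i => x i ^ 2) (fun _ _ => sq_nonneg _)
    (Finset.mem_univ i)).trans hx

open MvPolynomial in
theorem exists_card_near_critical_values_le (n D : ℕ) : ∃ K : ℕ,
    ∀ P : MvPolynomial (Fin n) ℝ, P.totalDegree ≤ D → ∀ r l : ℝ, 0 < r → ∀ t : Finset ℝ,
    (t : Set ℝ) = (fun x => eval x P) '' {x | ∑ i, x i ^ 2 ≤ r ^ 2 ∧
      ∑ i, eval x (pderiv i P) ^ 2 ≤ l ^ 2} → t.card ≤ K := by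
  classical
  obtain ⟨K, hK⟩ := exists_card_isLocalMinOn_ball_values_le n (2 * D)
  refine ⟨max K 1, fun P hP r l hr t ht => ?_⟩
  by_cases htn : (t : Set ℝ).Nontrivial
  swap
  · refine le_trans ?_ (le_max_right _ _)
    rw [Set.not_nontrivial_iff] at htn
    exact Finset.card_le_one_iff_subsingleton.2 htn
  refine le_trans ?_ (le_max_left _ _)
  have hc : ∀ g : MvPolynomial (Fin n) ℝ, Continuous fun x => eval x g := fun g => continuous_eval g
  set B : Set (Fin n → ℝ) := {x | ∑ i, x i ^ 2 ≤ r ^ 2} with hB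
  have hBc : IsCompact B := isCompact_sum_sq_le n r
  let F : MvPolynomial (Fin n) ℝ := ∑ i, pderiv i P ^ 2
  have hFe : ∀ x, eval x F = ∑ i, eval x (pderiv i P) ^ 2 := fun x => by simp [F]
  have hge : ∀ x ∈ B, l ^ 2 ≤ eval x F := by
    intro y hy
    by_contra! hlt
    rw [hFe] at hlt
    obtain ⟨c, rfl⟩ := subsingleton_near_critical_values hr (ht ▸ t.finite_toSet) hy hlt
    refine Set.not_nontrivial_iff.2 ?_ htn
    rw [ht]
    rintro _ ⟨x, -, rfl⟩ _ ⟨x', -, rfl⟩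
    simp
  have hg : 0 < (t : Set ℝ).infsep := t.finite_toSet.infsep_pos_iff_nontrivial.2 htn
  set g := (t : Set ℝ).infsep
  have hgap : ∀ τ ∈ t, ∀ σ ∈ t, τ ≠ σ → g ≤ |τ - σ| := fun τ hτ σ hσ hne =>
    Set.infsep_le_dist_of_mem (s := (t : Set ℝ)) hτ hσ hne
  have hWc : IsCompact (B ∩ ⋃ τ ∈ t, {x | |eval x P - τ| = g / 2}) :=
    hBc.inter_right (isClosed_biUnion_finset fun τ _ =>
      isClosed_eq ((hc P).sub continuous_const).abs continuous_const)
  obtain ⟨η', hη', hηle⟩ := hWc.exists_forall_le' (hc F).continuousOn (a := l ^ 2) (by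
    rintro x ⟨hx, hxW⟩
    obtain ⟨τ, hτ, hxτ⟩ := mem_iUnion₂.1 hxW
    rw [mem_ofPred_eq] at hxτ
    by_contra! hle
    rw [hFe] at hle
    have hmem : eval x P ∈ (t : Set ℝ) := by rw [ht]; exact ⟨x, ⟨hx, hle⟩, rfl⟩
    have hne : eval x P ≠ τ := fun h => by
      rw [h, sub_self, abs_zero] at hxτ
      linarith
    have := hgap _ hmem _ hτ hne
    linarith)
  set η := η' - l ^ 2
  have hη : 0 < η := sub_pos.2 hη'
  set δ := η / g with hδdef
  have hδ : 0 < δ := div_pos hη hg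
  have hδg : δ * g = η := div_mul_cancel₀ _ hg.ne'
  let h : MvPolynomial (Fin n) ℝ := F + C δ * P
  have hhe : ∀ x, eval x h = eval x F + δ * eval x P := fun x => by simp [h]
  have hh : h.totalDegree ≤ 2 * D := by
    refine (totalDegree_add _ _).trans (max_le (totalDegree_finsetSum_le fun i _ => ?_) ?_)
    · refine (totalDegree_pow _ _).trans ?_
      exact Nat.mul_le_mul_left 2 ((totalDegree_pderiv_le P i).trans hP)
    · refine (totalDegree_mul _ _).trans ?_
      rw [totalDegree_C]
      omega
  have hy : ∀ τ ∈ t, ∃ y ∈ B, IsLocalMinOn (fun x => eval x h) B y ∧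
      eval y h ≤ l ^ 2 + δ * τ ∧ l ^ 2 + δ * (τ - g / 2) < eval y h := by
    intro τ hτ
    have hτ' : τ ∈ (t : Set ℝ) := hτ
    rw [ht] at hτ'
    obtain ⟨x, ⟨hxB, hxl⟩, hxτ⟩ := hτ'
    change eval x P = τ at hxτ
    obtain ⟨y, ⟨hyB, hyτ⟩, hymin⟩ := (hBc.inter_right (isClosed_le
      ((hc P).sub continuous_const).abs continuous_const :
        IsClosed {x | |eval x P - τ| ≤ g / 2})).exists_isMinOn
      ⟨x, hxB, by rw [mem_ofPred_eq, hxτ, sub_self, abs_zero]; positivity⟩ (hc h).continuousOn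
    rw [mem_ofPred_eq] at hyτ
    have h1 : eval y h ≤ l ^ 2 + δ * τ := by
      have : eval y h ≤ eval x h := hymin
        ⟨hxB, by rw [mem_ofPred_eq, hxτ, sub_self, abs_zero]; positivity⟩
      rw [hhe x, hxτ, hFe] at this
      linarith
    have hyτ' : |eval y P - τ| < g / 2 := by
      refine lt_of_le_of_ne hyτ fun heq => ?_
      have h2 := hηle y ⟨hyB, mem_iUnion₂.2 ⟨τ, hτ, heq⟩⟩
      rw [hhe] at h1
      have h3 : δ * (τ - g / 2) ≤ δ * eval y P :=
        mul_le_mul_of_nonneg_left (by linarith [(abs_le.1 hyτ).1]) hδ.le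
      have : η = η' - l ^ 2 := rfl
      nlinarith
    refine ⟨y, hyB, ?_, h1, ?_⟩
    · have hO : IsOpen {x | |eval x P - τ| < g / 2} :=
        isOpen_lt ((hc P).sub continuous_const).abs continuous_const
      filter_upwards [mem_nhdsWithin_of_mem_nhds (hO.mem_nhds hyτ'), self_mem_nhdsWithin]
        with x hx hxB
      exact hymin ⟨hxB, le_of_lt hx⟩
    · rw [hhe]
      have := mul_lt_mul_of_pos_left (show τ - g / 2 < eval y P by
        linarith [(abs_lt.1 hyτ').1]) hδ
      linarith [hge y hyB]
  choose! y hyB hymin hyle hylt using hy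
  have hmono : ∀ τ ∈ t, ∀ σ ∈ t, τ < σ → eval (y τ) h < eval (y σ) h := by
    intro τ hτ σ hσ hlt
    have h1 := hgap σ hσ τ hτ hlt.ne'
    rw [abs_of_pos (sub_pos.2 hlt)] at h1
    have h2 := hyle τ hτ
    have h3 := hylt σ hσ
    have : δ * τ ≤ δ * (σ - g / 2) := mul_le_mul_of_nonneg_left (by linarith) hδ.le
    linarith
  have hinj : InjOn (fun τ => eval (y τ) h) t := by
    intro τ hτ σ hσ heq
    by_contra hne
    rcases lt_or_gt_of_ne hne with hlt | hlt
    · exact (hmono τ hτ σ hσ hlt).ne heq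
    · exact (hmono σ hσ τ hτ hlt).ne' heq
  rw [← Finset.card_image_of_injOn hinj]
  refine hK h hh r hr _ fun τ hτ => ?_
  obtain ⟨σ, hσ, rfl⟩ := Finset.mem_image.1 hτ
  exact ⟨y σ, hyB σ hσ, hymin σ hσ, rfl⟩

theorem coveringNumber_le_card {ε : ℝ} {S : Set ℝ} {t : Finset ℝ}
    (h : S ⊆ ⋃ c ∈ t, closedBall c ε) : coveringNumber ε S ≤ t.card :=
  Nat.sInf_le ⟨t, rfl, h⟩

/-- `S` can be covered by at most `B` closed intervals of radius `ε`. -/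
def CoveredBy (ε : ℝ) (S : Set ℝ) (B : ℝ) : Prop :=
  ∃ t : Finset ℝ, (t.card : ℝ) ≤ B ∧ S ⊆ ⋃ c ∈ t, closedBall c ε

theorem CoveredBy.coveringNumber_le {ε : ℝ} {S : Set ℝ} {B : ℝ} (h : CoveredBy ε S B) :
    (coveringNumber ε S : ℝ) ≤ B := by
  obtain ⟨t, ht, hS⟩ := h
  exact (Nat.cast_le.2 (coveringNumber_le_card hS)).trans ht

theorem coveredBy_biUnion {ι : Type*} {ε B : ℝ} {S : Set ℝ} (J : Finset ι) (T : ι → Set ℝ)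
    (hS : S ⊆ ⋃ j ∈ J, T j) (h : ∀ j ∈ J, CoveredBy ε (T j) B) : CoveredBy ε S (J.card * B) := by
  classical
  choose! t ht hT using h
  refine ⟨J.biUnion t, ?_, fun x hx => ?_⟩
  · calc ((J.biUnion t).card : ℝ) ≤ ∑ j ∈ J, ((t j).card : ℝ) := by
          exact_mod_cast Finset.card_biUnion_le
      _ ≤ ∑ j ∈ J, B := Finset.sum_le_sum ht
      _ = J.card * B := by simp
  · obtain ⟨j, hj, hxj⟩ := mem_iUnion₂.1 (hS hx)
    obtain ⟨c, hc, hxc⟩ := mem_iUnion₂.1 (hT j hj hxj)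
    exact mem_iUnion₂.2 ⟨c, Finset.mem_biUnion.2 ⟨j, hj, hc⟩, hxc⟩

theorem coveredBy_closedBall {ε R : ℝ} (hε : 0 < ε) (hR : 0 ≤ R) (c : ℝ) :
    CoveredBy ε (closedBall c R) (R / ε + 1) := by
  classical
  refine ⟨(Finset.range (⌊R / ε⌋₊ + 1)).image fun k : ℕ => c - R + (2 * k + 1) * ε, ?_,
    fun x hx => ?_⟩
  · have h1 : (((Finset.range (⌊R / ε⌋₊ + 1)).image
        fun k : ℕ => c - R + (2 * k + 1) * ε).card : ℝ) ≤ (⌊R / ε⌋₊ + 1 : ℕ) := by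
      refine Nat.cast_le.2 (Finset.card_image_le.trans ?_)
      simp
    refine h1.trans ?_
    push_cast
    have := Nat.floor_le (div_nonneg hR hε.le)
    linarith
  · rw [mem_closedBall, Real.dist_eq, abs_le] at hx
    have h0 : 0 ≤ (x - c + R) / (2 * ε) := div_nonneg (by linarith) (by linarith)
    have hle : (x - c + R) / (2 * ε) ≤ R / ε := by
      rw [div_le_div_iff₀ (by positivity) hε]
      nlinarith
    refine mem_iUnion₂.2 ⟨c - R + (2 * ⌊(x - c + R) / (2 * ε)⌋₊ + 1) * ε, ?_, ?_⟩
    · refine Finset.mem_image.2 ⟨⌊(x - c + R) / (2 * ε)⌋₊, ?_, rfl⟩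
      rw [Finset.mem_range, Nat.lt_succ_iff]
      exact Nat.floor_mono hle
    · have h1 := Nat.floor_le h0
      have h2 := Nat.lt_floor_add_one ((x - c + R) / (2 * ε))
      rw [le_div_iff₀ (by positivity)] at h1
      rw [div_lt_iff₀ (by positivity)] at h2
      rw [mem_closedBall, Real.dist_eq, abs_le]
      constructor <;> nlinarith

theorem CoveredBy.of_radius {ε R B : ℝ} {S : Set ℝ} (hε : 0 < ε) (hR : 0 ≤ R)
    (h : CoveredBy R S B) : CoveredBy ε S (B * (R / ε + 1)) := by
  obtain ⟨t, ht, hS⟩ := h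
  obtain ⟨u, hu, hSu⟩ := coveredBy_biUnion t _ hS fun c _ => coveredBy_closedBall hε hR c
  refine ⟨u, hu.trans ?_, hSu⟩
  gcongr

/-- A Euclidean ball of radius `r` is covered by `((2 * n + 1) * r / ρ) ^ n` balls of radius `ρ ≤ r`
centred in it. -/
theorem exists_finset_cover_closedBall {n : ℕ} (hn : 1 ≤ n) {r ρ : ℝ} (hρ : 0 < ρ) (hρr : ρ ≤ r) :
    ∃ J : Finset (EuclideanSpace ℝ (Fin n)), (J.card : ℝ) ≤ ((2 * n + 1) * (r / ρ)) ^ n ∧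
      (∀ y ∈ J, y ∈ closedBall (0 : EuclideanSpace ℝ (Fin n)) r) ∧
      ∀ x ∈ closedBall (0 : EuclideanSpace ℝ (Fin n)) r, ∃ y ∈ J, ‖x - y‖ ≤ ρ := by
  classical
  have hn' : (1 : ℝ) ≤ n := by exact_mod_cast hn
  set h : ℝ := ρ / n with hh
  have hpos : 0 < h := by positivity
  let g : EuclideanSpace ℝ (Fin n) → Fin n → ℕ := fun x i => ⌊(x i + r) / h⌋₊
  set m := ⌊2 * r / h⌋₊ + 1
  set s := closedBall (0 : EuclideanSpace ℝ (Fin n)) r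
  have hxi : ∀ x ∈ s, ∀ i, |x i| ≤ r := fun x hx i => by
    rw [← Real.norm_eq_abs]
    exact (PiLp.norm_apply_le x i).trans (mem_closedBall_zero_iff.1 hx)
  have hg : ∀ x ∈ s, g x ∈ Fintype.piFinset fun _ : Fin n => Finset.range m := by
    intro x hx
    rw [Fintype.mem_piFinset]
    intro i
    rw [Finset.mem_range, Nat.lt_succ_iff]
    refine Nat.floor_mono ?_
    have := (abs_le.1 (hxi x hx i)).2
    gcongr
    linarith
  have hclose : ∀ x ∈ s, ∀ y ∈ s, g x = g y → ‖x - y‖ ≤ ρ := by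
    intro x hx y hy hxy
    have hi : ∀ i, |x i - y i| ≤ h := by
      intro i
      have e : ⌊(x i + r) / h⌋₊ = ⌊(y i + r) / h⌋₊ := congrFun hxy i
      have hx0 : 0 ≤ (x i + r) / h := div_nonneg (by linarith [(abs_le.1 (hxi x hx i)).1]) hpos.le
      have hy0 : 0 ≤ (y i + r) / h := div_nonneg (by linarith [(abs_le.1 (hxi y hy i)).1]) hpos.le
      have a1 := Nat.floor_le hx0
      have a2 := Nat.lt_floor_add_one ((x i + r) / h)
      have b1 := Nat.floor_le hy0
      have b2 := Nat.lt_floor_add_one ((y i + r) / h)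
      rw [e, le_div_iff₀ hpos] at a1
      rw [e, div_lt_iff₀ hpos] at a2
      rw [le_div_iff₀ hpos] at b1
      rw [div_lt_iff₀ hpos] at b2
      exact abs_le.2 ⟨by linarith, by linarith⟩
    refine abs_le_of_sq_le_sq' ?_ hρ.le |>.2
    rw [EuclideanSpace.norm_sq_eq]
    calc ∑ i, ‖(x - y) i‖ ^ 2 ≤ ∑ i : Fin n, h ^ 2 := by
          refine Finset.sum_le_sum fun i _ => ?_
          rw [Real.norm_eq_abs]
          exact pow_le_pow_left₀ (abs_nonneg _) (hi i) 2
      _ = ρ * (ρ / n) := by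
          simp [hh]
          field_simp
      _ ≤ ρ ^ 2 := by
          rw [sq]
          gcongr
          exact div_le_self hρ.le hn'
  let T := (Fintype.piFinset fun _ : Fin n => Finset.range m).filter fun k => ∃ x ∈ s, g x = k
  have hT : ∀ k ∈ T, ∃ x ∈ s, g x = k := fun k hk => (Finset.mem_filter.1 hk).2
  choose! c hcs hcg using hT
  refine ⟨T.image c, ?_, ?_, ?_⟩
  · have h1 : (T.image c).card ≤ m ^ n := by
      refine Finset.card_image_le.trans ((Finset.card_filter_le _ _).trans ?_)
      simp
    calc ((T.image c).card : ℝ) ≤ (m : ℝ) ^ n := by exact_mod_cast h1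
      _ ≤ _ := by
        gcongr
        have h2 : 1 ≤ r / ρ := (one_le_div hρ).2 hρr
        have h3 := Nat.floor_le (show 0 ≤ 2 * r / h by have := hρ.le.trans hρr; positivity)
        have h4 : 2 * r / h = 2 * n * (r / ρ) := by rw [hh]; field_simp
        simp only [m]
        push_cast
        linarith
  · intro y hy
    obtain ⟨k, hk, rfl⟩ := Finset.mem_image.1 hy
    exact hcs k hk
  · intro x hx
    have hk : g x ∈ T := Finset.mem_filter.2 ⟨hg x hx, x, hx, rfl⟩
    exact ⟨c (g x), Finset.mem_image_of_mem c hk, hclose _ hx _ (hcs _ hk) (hcg _ hk).symm⟩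

theorem norm_sq_eq_sum_single {n : ℕ} (L : EuclideanSpace ℝ (Fin n) →L[ℝ] ℝ) :
    ‖L‖ ^ 2 = ∑ i, L (EuclideanSpace.single i 1) ^ 2 := by
  obtain ⟨v, rfl⟩ := (InnerProductSpace.toDual ℝ (EuclideanSpace ℝ (Fin n))).surjective L
  rw [LinearIsometryEquiv.norm_map, EuclideanSpace.norm_sq_eq]
  refine Finset.sum_congr rfl fun i _ => ?_
  simp [EuclideanSpace.inner_single_right]

theorem coveredBy_cell (n d : ℕ) : ∃ K : ℕ, ∀ {s : Set (EuclideanSpace ℝ (Fin n))},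
    UniqueDiffOn ℝ s → s ⊆ closure (interior s) → Convex ℝ s →
    ∀ {f : EuclideanSpace ℝ (Fin n) → ℝ}, ContDiffOn ℝ (d + 1 : ℕ) f s → ∀ {M A ρ ε l : ℝ},
    (∀ x ∈ s, ‖iteratedFDerivWithin ℝ (d + 1) f s x‖ ≤ M) → 0 < A → 0 < ρ → 0 < ε → 0 ≤ l →
    M * ρ ^ (d + 1) ≤ A * ε → ∀ x₀ ∈ s,
    CoveredBy ε (f '' {x | x ∈ s ∧ ‖x - x₀‖ ≤ ρ ∧ ‖fderivWithin ℝ f s x‖ ≤ l})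
      (K * (3 * A + 1 + 2 * (l * (ρ / ε)))) := by
  obtain ⟨K, hK⟩ := exists_cover_near_critical_values n d
  refine ⟨K, fun {s} hs hsc hconv {f} hf {M A ρ ε l} hM hA hρ hε hl hMA x₀ hx₀ => ?_⟩
  obtain ⟨P, hPd, hP⟩ := exists_taylor_polynomial hs hsc hconv hx₀ hf hM
  have hM0 : 0 ≤ M := (norm_nonneg _).trans (hM x₀ hx₀)
  obtain ⟨t, ht, hcov⟩ := hK P hPd 0 ρ (l + A * ε / ρ) hρ (by positivity)
  have h1 : CoveredBy (3 * A * ε + 2 * l * ρ)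
      (f '' {x | x ∈ s ∧ ‖x - x₀‖ ≤ ρ ∧ ‖fderivWithin ℝ f s x‖ ≤ l}) K := by
    refine ⟨t, by exact_mod_cast ht, ?_⟩
    rintro _ ⟨x, ⟨hxs, hxρ, hxl⟩, rfl⟩
    obtain ⟨hf0, hf1⟩ := hP x hxs
    obtain ⟨c, hc, hxc⟩ := hcov (x - x₀).ofLp
      (fun i => by
        rw [Pi.zero_apply, sub_zero, ← Real.norm_eq_abs]
        exact (PiLp.norm_apply_le (x - x₀) i).trans hxρ)
      (fun i => by
        have e1 : |fderivWithin ℝ f s x (EuclideanSpace.single i 1)| ≤ l := by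
          rw [← Real.norm_eq_abs]
          refine (ContinuousLinearMap.le_opNorm _ _).trans ?_
          simpa using hxl
        have e2 : M * ‖x - x₀‖ ^ d ≤ A * ε / ρ := by
          rw [le_div_iff₀ hρ]
          calc M * ‖x - x₀‖ ^ d * ρ ≤ M * ρ ^ d * ρ := by gcongr
            _ = M * ρ ^ (d + 1) := by ring
            _ ≤ _ := hMA
        have e3 := hf1 i
        rw [abs_le] at e1 e3 ⊢
        constructor <;> linarith [e1.1, e1.2, e3.1, e3.2])
    refine mem_iUnion₂.2 ⟨c, hc, ?_⟩
    rw [mem_closedBall, Real.dist_eq]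
    have e0 : |f x - MvPolynomial.eval (x - x₀).ofLp P| ≤ A * ε :=
      hf0.trans ((by gcongr : M * ‖x - x₀‖ ^ (d + 1) ≤ M * ρ ^ (d + 1)).trans hMA)
    have e4 : 2 * (l + A * ε / ρ) * ρ = 2 * A * ε + 2 * l * ρ := by field_simp; ring
    rw [e4] at hxc
    calc |f x - c| ≤ _ + _ := abs_sub_le _ _ _
      _ ≤ A * ε + (2 * A * ε + 2 * l * ρ) := add_le_add e0 hxc
      _ = _ := by ring
  have h2 := h1.of_radius hε (by positivity)
  have e : (3 * A * ε + 2 * l * ρ) / ε + 1 = 3 * A + 1 + 2 * (l * (ρ / ε)) := by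
    field_simp; ring
  rwa [e] at h2

/-- The case of vanishing top derivative and radius `0`: the values are those of a polynomial. -/
theorem exists_coveringNumber_zero_le (n d : ℕ) : ∃ K : ℕ, ∀ {r l : ℝ}, 0 < r → 0 ≤ l →
    ∀ {f : EuclideanSpace ℝ (Fin n) → ℝ}, ContDiffOn ℝ (d + 1 : ℕ) f (closedBall 0 r) →
    (∀ x ∈ closedBall (0 : EuclideanSpace ℝ (Fin n)) r,
      ‖iteratedFDerivWithin ℝ (d + 1) f (closedBall 0 r) x‖ ≤ 0) →
    _root_.coveringNumber 0 (nearCritValues n r l f) ≤ K := by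
  obtain ⟨K, hK⟩ := exists_card_near_critical_values_le n d
  refine ⟨K, fun {r l} hr hl {f} hf hM => ?_⟩
  have hint : (interior (closedBall (0 : EuclideanSpace ℝ (Fin n)) r)).Nonempty := by
    rw [interior_closedBall _ hr.ne']
    exact ⟨0, mem_ball_self hr⟩
  obtain ⟨P, hPd, hP⟩ := exists_taylor_polynomial
    (uniqueDiffOn_convex (convex_closedBall _ _) hint)
    (by rw [interior_closedBall _ hr.ne', closure_ball _ hr.ne'])
    (convex_closedBall _ _) (mem_closedBall_self hr.le) hf hM
  have himg : nearCritValues n r l f = (fun x => MvPolynomial.eval x P) ''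
      {x | ∑ i, x i ^ 2 ≤ r ^ 2 ∧ ∑ i, MvPolynomial.eval x (MvPolynomial.pderiv i P) ^ 2 ≤ l ^ 2} := by
    have hnorm : ∀ x : EuclideanSpace ℝ (Fin n), x ∈ closedBall (0 : EuclideanSpace ℝ (Fin n)) r ↔
        ∑ i, x i ^ 2 ≤ r ^ 2 := fun x => by
      rw [mem_closedBall_zero_iff, ← sq_le_sq₀ (norm_nonneg _) hr.le, EuclideanSpace.norm_sq_eq]
      simp
    have hfx : ∀ x ∈ closedBall (0 : EuclideanSpace ℝ (Fin n)) r,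
        f x = MvPolynomial.eval x.ofLp P := fun x hx => by
      have := (hP x hx).1
      simp only [zero_mul, sub_zero] at this
      exact sub_eq_zero.1 (abs_nonpos_iff.1 this)
    have hdf : ∀ x ∈ closedBall (0 : EuclideanSpace ℝ (Fin n)) r,
        (‖fderivWithin ℝ f (closedBall 0 r) x‖ ≤ l ↔
        ∑ i, MvPolynomial.eval x.ofLp (MvPolynomial.pderiv i P) ^ 2 ≤ l ^ 2) := fun x hx => by
      rw [← sq_le_sq₀ (norm_nonneg _) hl, norm_sq_eq_sum_single]
      refine iff_of_eq (congrArg (· ≤ l ^ 2) (Finset.sum_congr rfl fun i _ => ?_))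
      have := (hP x hx).2 i
      simp only [zero_mul, sub_zero] at this
      rw [sub_eq_zero.1 (abs_nonpos_iff.1 this)]
    ext τ
    constructor
    · rintro ⟨x, ⟨hx, hxl⟩, rfl⟩
      exact ⟨x.ofLp, ⟨(hnorm x).1 hx, (hdf x hx).1 hxl⟩, (hfx x hx).symm⟩
    · rintro ⟨x, ⟨hx, hxl⟩, rfl⟩
      have hx' := (hnorm (WithLp.toLp 2 x)).2 hx
      exact ⟨WithLp.toLp 2 x, ⟨hx', (hdf _ hx').2 hxl⟩, hfx _ hx'⟩
  by_cases hfin : (nearCritValues n r l f).Finite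
  · refine (coveringNumber_le_card (t := hfin.toFinset) fun x hx => ?_).trans
      (hK P hPd r l hr hfin.toFinset (by rw [hfin.coe_toFinset, himg]))
    exact mem_iUnion₂.2 ⟨x, hfin.mem_toFinset.2 hx, by simp⟩
  · have : {N : ℕ | ∃ t : Finset ℝ, t.card = N ∧
        nearCritValues n r l f ⊆ ⋃ c ∈ t, closedBall c 0} = ∅ := by
      refine eq_empty_of_forall_notMem fun N hN => hfin ?_
      obtain ⟨t, -, ht⟩ := hN
      refine t.finite_toSet.subset fun x hx => ?_
      obtain ⟨c, hc, hxc⟩ := mem_iUnion₂.1 (ht hx)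
      rw [closedBall_zero, mem_singleton_iff] at hxc
      exact hxc ▸ hc
    rw [_root_.coveringNumber, this, Nat.sInf_empty]
    exact Nat.zero_le _

theorem norm_iteratedFDerivWithin_le_taylorConst {n d : ℕ} {r : ℝ} (hr : 0 < r)
    {f : EuclideanSpace ℝ (Fin n) → ℝ} (hf : ContDiffOn ℝ d f (closedBall 0 r)) :
    0 ≤ taylorConst n d r f ∧ ∀ x ∈ closedBall (0 : EuclideanSpace ℝ (Fin n)) r,
      ‖iteratedFDerivWithin ℝ d f (closedBall 0 r) x‖ ≤
        d.factorial * taylorConst n d r f / r ^ d := by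
  have hint : (interior (closedBall (0 : EuclideanSpace ℝ (Fin n)) r)).Nonempty := by
    rw [interior_closedBall _ hr.ne']
    exact ⟨0, mem_ball_self hr⟩
  set s := closedBall (0 : EuclideanSpace ℝ (Fin n)) r with hs
  have hcont : ContinuousOn (iteratedFDerivWithin ℝ d f s) s :=
    hf.continuousOn_iteratedFDerivWithin le_rfl (uniqueDiffOn_convex (convex_closedBall _ _) hint)
  obtain ⟨C, hC⟩ := (isCompact_closedBall _ _).exists_bound_of_continuousOn hcont
  have hbdd : BddAbove (range fun x => ⨆ _ : x ∈ s, ‖iteratedFDerivWithin ℝ d f s x‖) := by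
    refine ⟨max C 0, ?_⟩
    rintro _ ⟨x, rfl⟩
    by_cases hx : x ∈ s
    · simpa [hx] using Or.inl (hC x hx)
    · simp [hx]
  refine ⟨mul_nonneg (by positivity) (Real.iSup_nonneg fun x => Real.iSup_nonneg fun _ =>
    norm_nonneg _), fun x hx => ?_⟩
  have h := le_ciSup hbdd x
  rw [ciSup_pos hx] at h
  refine h.trans_eq ?_
  rw [taylorConst, ← hs]
  field_simp

/-- entropy bounds for the set of λ-near-critical values of a C^d
function on the ball of radius r in ℝ^n (the case m = 1 of Theorem 9.2 of
Yomdin–Comte). -/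
theorem stmt_2 (n d : ℕ) (hn : 1 ≤ n) (hd : 1 ≤ d) :
    ∃ c : ℝ, 0 < c ∧
      ∀ r : ℝ, 0 < r → ∀ lam : ℝ, 0 ≤ lam →
        ∀ f : EuclideanSpace ℝ (Fin n) → ℝ,
          ContDiffOn ℝ d f (closedBall (0 : EuclideanSpace ℝ (Fin n)) r) →
          (∀ ε : ℝ, taylorConst n d r f ≤ ε →
            (coveringNumber ε (nearCritValues n r lam f) : ℝ)
              ≤ c * (1 + lam * (r / ε))) ∧
          (∀ ε : ℝ, 0 < ε → ε ≤ taylorConst n d r f →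
            (coveringNumber ε (nearCritValues n r lam f) : ℝ)
              ≤ c * ((taylorConst n d r f / ε) ^ ((n : ℝ) / d)
                  + lam * (r / ε) * (taylorConst n d r f / ε) ^ (((n : ℝ) - 1) / d))) := by
  obtain ⟨d, rfl⟩ : ∃ e, d = e + 1 := ⟨d - 1, by omega⟩
  obtain ⟨K₁, hK₁⟩ := coveredBy_cell n d
  obtain ⟨K₂, hK₂⟩ := exists_coveringNumber_zero_le n d
  set A : ℝ := ((d + 1).factorial : ℝ) with hA
  have hA1 : 1 ≤ A := Nat.one_le_cast.2 (d + 1).factorial_pos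
  set C₁ : ℝ := K₁ * (3 * A + 1) with hC₁
  have hC₁0 : 0 ≤ C₁ := by positivity
  set C₂ : ℝ := (2 * n + 1) ^ n * C₁ with hC₂
  have hC₂0 : 0 ≤ C₂ := by positivity
  have hbound : ∀ q : ℝ, 0 ≤ q → K₁ * (3 * A + 1 + 2 * q) ≤ C₁ * (1 + q) := fun q hq => by
    rw [hC₁, mul_assoc]
    gcongr
    nlinarith
  refine ⟨C₁ + C₂ + K₂ + 1, by positivity, fun r hr lam hlam f hf => ?_⟩
  have hint : (interior (closedBall (0 : EuclideanSpace ℝ (Fin n)) r)).Nonempty := by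
    rw [interior_closedBall _ hr.ne']
    exact ⟨0, mem_ball_self hr⟩
  have hconv := convex_closedBall (0 : EuclideanSpace ℝ (Fin n)) r
  have huniq := uniqueDiffOn_convex hconv hint
  have hcl : closedBall (0 : EuclideanSpace ℝ (Fin n)) r ⊆ closure (interior (closedBall 0 r)) := by
    rw [interior_closedBall _ hr.ne', closure_ball _ hr.ne']
  obtain ⟨hR0, hM⟩ := norm_iteratedFDerivWithin_le_taylorConst hr hf
  set R := taylorConst n (d + 1) r f with hR
  have hA0 : 0 < A := zero_lt_one.trans_le hA1
  refine ⟨fun ε hε => ?_, fun ε hε0 hε => ?_⟩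
  · rcases (hR0.trans hε).eq_or_lt with h0 | hε0
    · subst h0
      have h1 := hK₂ hr hlam hf fun x hx => by
        simpa [le_antisymm hε hR0] using hM x hx
      have h2 : (_root_.coveringNumber 0 (nearCritValues n r lam f) : ℝ) ≤ K₂ := by exact_mod_cast h1
      refine h2.trans ?_
      rw [div_zero, mul_zero, add_zero, mul_one]
      linarith
    · have h1 := hK₁ huniq hcl hconv hf hM hA0 hr hε0 hlam (by rw [div_mul_cancel₀ _ (by positivity)]; gcongr) 0
        (mem_closedBall_self hr.le)
      have h2 : {x | x ∈ closedBall (0 : EuclideanSpace ℝ (Fin n)) r ∧ ‖x - 0‖ ≤ r ∧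
          ‖fderivWithin ℝ f (closedBall 0 r) x‖ ≤ lam} =
          {x ∈ closedBall (0 : EuclideanSpace ℝ (Fin n)) r |
            ‖fderivWithin ℝ f (closedBall (0 : EuclideanSpace ℝ (Fin n)) r) x‖ ≤ lam} := by
        ext x
        simp
      rw [h2] at h1
      have hq : 0 ≤ lam * (r / ε) := by positivity
      refine h1.coveringNumber_le.trans ((hbound _ hq).trans ?_)
      gcongr
      have : (0 : ℝ) ≤ K₂ := Nat.cast_nonneg _
      linarith
  · have hRpos : 0 < R := hε0.trans_le hε
    have hx0 : 0 < R / ε := by positivity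
    have hx1 : 1 ≤ R / ε := (one_le_div hε0).2 hε
    set u : ℝ := (R / ε) ^ (1 / ((d + 1 : ℕ) : ℝ)) with hu
    have hd0 : ((d + 1 : ℕ) : ℝ) ≠ 0 := Nat.cast_ne_zero.2 d.succ_ne_zero
    have hu1 : 1 ≤ u := Real.one_le_rpow hx1 (by positivity)
    have hu0 : 0 < u := zero_lt_one.trans_le hu1
    have hud : u ^ (d + 1) = R / ε := by
      rw [hu, ← Real.rpow_natCast, ← Real.rpow_mul hx0.le, one_div_mul_cancel hd0, Real.rpow_one]
    have hun : (R / ε) ^ ((n : ℝ) / ((d + 1 : ℕ) : ℝ)) = u ^ n := by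
      rw [hu, ← Real.rpow_natCast, ← Real.rpow_mul hx0.le]
      congr 1
      ring
    have hun1 : (R / ε) ^ (((n : ℝ) - 1) / ((d + 1 : ℕ) : ℝ)) = u ^ n / u := by
      rw [sub_div, Real.rpow_sub hx0, hun]
    obtain ⟨J, hJ, hJs, hJc⟩ := exists_finset_cover_closedBall hn (r := r) (ρ := r / u)
      (by positivity) (div_le_self hr.le hu1)
    have h1 := coveredBy_biUnion (S := nearCritValues n r lam f) J
      (fun y => f '' {x | x ∈ closedBall (0 : EuclideanSpace ℝ (Fin n)) r ∧ ‖x - y‖ ≤ r / u ∧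
          ‖fderivWithin ℝ f (closedBall 0 r) x‖ ≤ lam})
      (by
        rintro _ ⟨x, ⟨hx, hxl⟩, rfl⟩
        obtain ⟨y, hy, hxy⟩ := hJc x hx
        exact mem_iUnion₂.2 ⟨y, hy, x, ⟨hx, hxy, hxl⟩, rfl⟩)
      fun y hy => hK₁ huniq hcl hconv hf hM hA0 (by positivity) hε0 hlam
        (by rw [div_pow, hud]; exact le_of_eq (by rw [hA]; field_simp)) y (hJs y hy)
    have hq : 0 ≤ lam * (r / u / ε) := by positivity
    rw [hun, hun1]
    calc _ ≤ _ := h1.coveringNumber_le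
      _ ≤ ((2 * n + 1) * (r / (r / u))) ^ n * (C₁ * (1 + lam * (r / u / ε))) :=
        mul_le_mul hJ (hbound _ hq) (by positivity) (by positivity)
      _ = C₂ * (u ^ n + lam * (r / ε) * (u ^ n / u)) := by
        rw [div_div_cancel₀ hr.ne', mul_pow, hC₂]
        field_simp
      _ ≤ _ := by
        gcongr
        have : (0 : ℝ) ≤ K₂ := Nat.cast_nonneg _
        linarith
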